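/- arXiv:1308.2211 — 3 statements merged into one kernel-verified Lean document; each statement's English description precedes it below -/
import Mathlib

section
/- If G is a finite simple graph having no subgraph isomorphic to the wheel graph W_n for any odd n with n ≥ 5, then τ(G) ≤ 2ν(G). -/
open SimpleGraph

variable {V : Type*}

/-- `S` is a set of pairwise edge-disjoint triangles of `G` (two triangles, viewed as
3-element vertex sets, are edge-disjoint iff they share at most one vertex). -/
def EdgeDisjointTriangles [DecidableEq V] (G : SimpleGraph V) (S : Finset (Finset V)) : Prop :=
  (∀ t ∈ S, G.IsNClique 3 t) ∧
    ∀ t₁ ∈ S, ∀ t₂ ∈ S, t₁ ≠ t₂ → (t₁ ∩ t₂).card ≤ 1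

/-- ν(G): the maximum size of a set of pairwise edge-disjoint triangles of `G`. -/
noncomputable def triNu [DecidableEq V] (G : SimpleGraph V) : ℕ :=
  sSup {n | ∃ S : Finset (Finset V), EdgeDisjointTriangles G S ∧ S.card = n}

/-- τ(G): the minimum size of an edge set `Y` such that `G - Y` is triangle-free. -/
noncomputable def triTau [DecidableEq V] (G : SimpleGraph V) : ℕ :=
  sInf {n | ∃ Y : Finset (Sym2 V), ↑Y ⊆ G.edgeSet ∧
    (G.deleteEdges ↑Y).CliqueFree 3 ∧ Y.card = n}
def NoOdd (H : SimpleGraph V) : Prop :=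
  ∀ (u : V) (w : H.Walk u u), w.IsCycle → Odd w.length → w.length < 5

def Good (H : SimpleGraph V) (x : V) : Prop :=
  ∃ (M : Finset (Sym2 V)) (C : Finset V), C.card ≤ M.card ∧ (∀ e ∈ M, e ∈ H.edgeSet) ∧
    (∀ e ∈ M, ∀ f ∈ M, ∀ v, v ∈ e → v ∈ f → e = f) ∧
    (∀ a b, H.Adj a b → s(a, b) ∈ M ∨ a ∈ C ∨ b ∈ C) ∧ (x ∈ C ∨ ∀ e ∈ M, x ∉ e)

lemma NoOdd.mono {H K : SimpleGraph V} (h : H ≤ K) (hK : NoOdd K) : NoOdd H := by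
  intro u w hw ho
  have := hK u (w.mapLe h) (hw.mapLe h) (by simpa using ho)
  simpa using this

lemma isCycle_close {H : SimpleGraph V} {u v : V} (p : H.Walk u v) (hp : p.IsPath)
    (hl : 2 ≤ p.length) (h : H.Adj v u) : (Walk.cons h p).IsCycle := by
  rw [Walk.cons_isCycle_iff]
  refine ⟨hp, ?_⟩
  cases p with
  | nil => simp at hl
  | @cons _ z _ h' q =>
    rw [Walk.cons_isPath_iff] at hp
    intro hmem
    rw [Walk.edges_cons, List.mem_cons] at hmem
    rcases hmem with hm | hm
    · have : v = z := by
        rw [Sym2.eq_swap] at hm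
        exact Sym2.congr_right.1 hm
      subst this
      have := Walk.length_eq_zero_iff.2 (Walk.isPath_iff_nil.1 hp.1)
      simp at hl
      omega
    · exact hp.2 (Walk.snd_mem_support_of_mem_edges q hm)

lemma NoOdd.close {H : SimpleGraph V} (hH : NoOdd H) {u v : V} (p : H.Walk u v) (hp : p.IsPath)
    (hl : 4 ≤ p.length) (he : Even p.length) (h : H.Adj v u) : False := by
  have := hH _ _ (isCycle_close p hp (by omega) h) (by simpa using he.add_one)
  simp at this
  omega

lemma NoOdd.five {H : SimpleGraph V} (hH : NoOdd H) {a b c d e : V} (hab : H.Adj a b)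
    (hbc : H.Adj b c) (hcd : H.Adj c d) (hde : H.Adj d e) (hea : H.Adj e a)
    (hac : a ≠ c) (had : a ≠ d) (hbd : b ≠ d) (hbe : b ≠ e) (hce : c ≠ e) : False := by
  refine hH.close (.cons hab (.cons hbc (.cons hcd (.cons hde .nil)))) ?_ (by simp)
    (by simp; decide) hea
  simp [Walk.cons_isPath_iff, hab.ne, hbc.ne, hcd.ne, hde.ne, hea.ne.symm, *]

lemma split_of_not_path [DecidableEq V] {H : SimpleGraph V} {u v : V} (p : H.Walk u v) (hp : ¬ p.IsPath) :
    ∃ (x : V) (p₁ : H.Walk u x) (p₂ : H.Walk x x) (p₃ : H.Walk x v),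
      p.length = p₁.length + p₂.length + p₃.length ∧ 0 < p₂.length := by
  induction p with
  | nil => simp at hp
  | @cons a b c h q ih =>
    by_cases hq : q.IsPath
    · have ha : a ∈ q.support := by
        by_contra hn
        exact hp ((Walk.cons_isPath_iff h q).2 ⟨hq, hn⟩)
      refine ⟨a, .nil, .cons h (q.takeUntil a ha), q.dropUntil a ha, ?_, by simp⟩
      have := congrArg Walk.length (q.take_spec ha)
      rw [Walk.length_append] at this
      simp
      omega
    · obtain ⟨x, p₁, p₂, p₃, h1, h2⟩ := ih hq
      exact ⟨x, .cons h p₁, p₂, p₃, by simp; omega, h2⟩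

lemma exists_odd_cycle [DecidableEq V] {H : SimpleGraph V} (n : ℕ) : ∀ (u : V) (w : H.Walk u u), w.length = n →
    Odd n → ∃ (v : V) (c : H.Walk v v), c.IsCycle ∧ Odd c.length := by
  induction n using Nat.strong_induction_on with
  | _ n ih =>
    intro u w hw ho
    cases w with
    | nil => simp at hw; subst hw; simp at ho
    | @cons _ v _ h p =>
      simp at hw
      by_cases hp : p.IsPath
      · refine ⟨_, _, isCycle_close p hp ?_ h, by simpa [hw] using ho⟩
        rcases Nat.lt_or_ge p.length 2 with h2 | h2
        · exfalso
          interval_cases hl : p.length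
          · have := Walk.eq_of_length_eq_zero hl
            exact h.ne this.symm
          · subst hw; exact absurd ho (by decide)
        · exact h2
      · obtain ⟨x, p₁, p₂, p₃, h1, h2⟩ := split_of_not_path p hp
        by_cases h3 : Odd p₂.length
        · exact ih _ (by omega) x p₂ rfl h3
        · refine ih (p₁.length + p₃.length + 1) (by omega) _ (.cons h (p₁.append p₃)) (by simp) ?_
          grind

lemma bip_or_triangle [DecidableEq V] {H : SimpleGraph V} (hH : NoOdd H) :
    Nonempty (H.Coloring Bool) ∨ ∃ a b c, H.Adj a b ∧ H.Adj b c ∧ H.Adj a c := by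
  by_cases h : ∃ (u : V) (w : H.Walk u u), Odd w.length
  · right
    obtain ⟨u, w, hw⟩ := h
    obtain ⟨v, c, hc, ho⟩ := exists_odd_cycle _ u w rfl hw
    have h5 := hH v c hc ho
    have h3 := hc.three_le_length
    have : c.length = 3 := by grind
    match c, this with
    | .cons h1 (.cons h2 (.cons h3 .nil)), _ => exact ⟨_, _, _, h1, h2, h3.symm⟩
  · left
    have : H.Colorable 2 := by
      rw [two_colorable_iff_forall_loop_even]
      intro u w
      by_contra hn
      exact h ⟨u, w, by simpa using hn⟩
    obtain ⟨c⟩ := this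
    exact ⟨Coloring.mk (fun v => decide (c v = 0)) (by
      intro a b hab heq
      have h1 := c.valid hab
      simp at heq
      generalize c a = i at *
      generalize c b = j at *
      revert i j; decide)⟩

def Cov (H : SimpleGraph V) (C : Finset V) : Prop := ∀ a b, H.Adj a b → a ∈ C ∨ b ∈ C

lemma exists_min_cover [Fintype V] (H : SimpleGraph V) :
    ∃ C, Cov H C ∧ ∀ D, Cov H D → C.card ≤ D.card := by
  classical
  obtain ⟨C, hC, hm⟩ := Finset.exists_min_image (Finset.univ.filter (fun C => Cov H C)) Finset.card
    ⟨Finset.univ, by rw [Finset.mem_filter]; exact ⟨Finset.mem_univ _, fun a b _ => Or.inl (Finset.mem_univ a)⟩⟩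
  exact ⟨C, by simpa using hC, fun D hD => hm D (by simpa using hD)⟩

lemma konig [Fintype V] [DecidableEq V] {H : SimpleGraph V} (c : H.Coloring Bool) (C : Finset V)
    (hC : Cov H C) (hmin : ∀ D, Cov H D → C.card ≤ D.card) :
    ∃ M : Finset (Sym2 V), M.card = C.card ∧ (∀ e ∈ M, e ∈ H.edgeSet) ∧
      (∀ e ∈ M, ∀ f ∈ M, ∀ v, v ∈ e → v ∈ f → e = f) := by
  classical
  let t : C → Finset V := fun x => Finset.univ.filter (fun v => H.Adj x v ∧ v ∉ C)
  -- one-sided Hall condition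
  have key : ∀ (i : Bool) (S : Finset V), S ⊆ C → (∀ v ∈ S, c v = i) →
      S.card ≤ (Finset.univ.filter (fun v => v ∉ C ∧ ∃ s ∈ S, H.Adj s v)).card := by
    intro i S hS hi
    have := hmin ((C \ S) ∪ Finset.univ.filter (fun v => v ∉ C ∧ ∃ s ∈ S, H.Adj s v)) (by
      intro a b hab
      have h1 := hC a b hab
      have h2 := c.valid hab
      have h3 := hab.symm
      simp only [Finset.mem_union, Finset.mem_sdiff, Finset.mem_filter, Finset.mem_univ, true_and]
      grind)
    have h2 := Finset.card_union_le (C \ S) (Finset.univ.filter (fun v => v ∉ C ∧ ∃ s ∈ S, H.Adj s v))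
    have h3 := Finset.card_sdiff_add_card_eq_card hS
    omega
  have hall : ∀ s : Finset C, s.card ≤ (s.biUnion t).card := by
    intro s
    let S : Finset V := s.map (Function.Embedding.subtype _)
    have hSC : S ⊆ C := by
      intro v hv
      simp [S] at hv
      exact hv.1
    have hcard : s.card = S.card := by simp [S]
    have h1 := key true (S.filter (fun v => c v = true)) (by grind) (by grind)
    have h2 := key false (S.filter (fun v => ¬ c v = true)) (by grind) (by grind)
    have h3 := Finset.card_filter_add_card_filter_not (s := S) (fun v => c v = true)
    have hd : Disjoint (Finset.univ.filter (fun v => v ∉ C ∧ ∃ s ∈ S.filter (fun v => c v = true), H.Adj s v))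
       (Finset.univ.filter (fun v => v ∉ C ∧ ∃ s ∈ S.filter (fun v => ¬ c v = true), H.Adj s v)) := by
      rw [Finset.disjoint_left]
      intro v hv hv'
      simp only [Finset.mem_filter, Finset.mem_univ, true_and] at hv hv'
      obtain ⟨_, p, hp, hpv⟩ := hv
      obtain ⟨_, q, hq, hqv⟩ := hv'
      have := c.valid hpv
      have := c.valid hqv
      grind
    have h4 := Finset.card_union_of_disjoint hd
    have h5 := Finset.card_le_card (t := s.biUnion t) (show (Finset.univ.filter (fun v => v ∉ C ∧ ∃ s ∈ S.filter (fun v => c v = true), H.Adj s v)) ∪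
       (Finset.univ.filter (fun v => v ∉ C ∧ ∃ s ∈ S.filter (fun v => ¬ c v = true), H.Adj s v)) ⊆ s.biUnion t by
      intro v hv
      have : ∃ p ∈ S, H.Adj p v ∧ v ∉ C := by
        rcases Finset.mem_union.1 hv with hv | hv <;>
        · obtain ⟨h1, p, hp, h2⟩ := (Finset.mem_filter.1 hv).2
          exact ⟨p, (Finset.mem_filter.1 hp).1, h2, h1⟩
      obtain ⟨p, hp, h⟩ := this
      simp only [S, Finset.mem_map] at hp
      obtain ⟨p', hp', rfl⟩ := hp
      rw [Finset.mem_biUnion]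
      exact ⟨p', hp', by simpa [t] using h⟩)
    rw [h4] at h5
    omega
  obtain ⟨f, hf, hft⟩ := (Finset.all_card_le_biUnion_card_iff_exists_injective t).1 hall
  have hf1 : ∀ x : C, H.Adj x (f x) := fun x => by have := hft x; simp [t] at this; exact this.1
  have hf2 : ∀ x : C, f x ∉ C := fun x => by have := hft x; simp [t] at this; exact this.2
  have hinj : ∀ x y : C, ∀ v, v ∈ s((x : V), f x) → v ∈ s((y : V), f y) → x = y := by
    intro x y v hx hy
    rw [Sym2.mem_iff] at hx hy
    have := hf2 x
    have := hf2 y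
    have := x.2
    have := y.2
    rcases hx with rfl | rfl <;> rcases hy with hy | hy
    · exact Subtype.ext hy
    · grind
    · grind
    · exact hf hy
  refine ⟨Finset.univ.image (fun x : C => s((x : V), f x)), ?_, ?_, ?_⟩
  · rw [Finset.card_image_of_injective]
    · simp
    · intro x y hxy
      simp only at hxy
      exact hinj x y x (by simp) (by rw [← hxy]; simp)
  · intro e he
    simp at he
    obtain ⟨x, hx, rfl⟩ := he
    exact hf1 ⟨x, hx⟩
  · intro e he g hg v hv hv'
    rw [Finset.mem_image] at he hg
    obtain ⟨x, -, rfl⟩ := he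
    obtain ⟨y, -, rfl⟩ := hg
    rw [hinj x y v hv hv']

def delV (H : SimpleGraph V) (y : V) : SimpleGraph V where
  Adj a b := H.Adj a b ∧ a ≠ y ∧ b ≠ y
  symm := ⟨fun _ _ h => ⟨h.1.symm, h.2.2, h.2.1⟩⟩
  loopless := ⟨fun _ h => h.1.ne rfl⟩

lemma delV_le (H : SimpleGraph V) (y : V) : delV H y ≤ H := fun _ _ h => h.1

lemma good_bip [Fintype V] [DecidableEq V] {H : SimpleGraph V} (c : H.Coloring Bool) (x : V) :
    Good H x := by
  obtain ⟨C, hC, hm⟩ := exists_min_cover H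
  obtain ⟨D, hD, hDm⟩ := exists_min_cover (delV H x)
  by_cases h : D.card < C.card
  · have hcov : Cov H (insert x D) := by
      intro a b hab
      by_cases ha : a = x
      · simp [ha]
      by_cases hb : b = x
      · simp [hb]
      have := hD a b ⟨hab, ha, hb⟩
      simp; tauto
    have hc : (insert x D).card ≤ C.card := (Finset.card_insert_le _ _).trans h
    obtain ⟨M, h1, h2, h3⟩ := konig c C hC hm
    exact ⟨M, insert x D, by omega, h2, h3, fun a b hab => Or.inr (hcov a b hab), by simp⟩
  · obtain ⟨M, h1, h2, h3⟩ := konig (H := delV H x)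
      (Coloring.mk (fun v => c v) (fun hab => c.valid hab.1)) D hD hDm
    refine ⟨M, C, by omega, ?_, h3, fun a b hab => Or.inr (hC a b hab), Or.inr ?_⟩
    · intro e he
      exact edgeSet_mono (delV_le H x) (h2 e he)
    · intro e he hx
      have := h2 e he
      induction e with | _ a b =>
      have h : (delV H x).Adj a b := this
      simp at hx
      rcases hx with rfl | rfl
      · exact h.2.1 rfl
      · exact h.2.2 rfl

lemma Good.of_disjoint [DecidableEq V] {H : SimpleGraph V} {x : V}
    {M₁ M₂ : Finset (Sym2 V)} {C₁ C₂ : Finset V}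
    (hc₁ : C₁.card ≤ M₁.card) (hc₂ : C₂.card ≤ M₂.card)
    (hM₁ : ∀ e ∈ M₁, e ∈ H.edgeSet) (hM₂ : ∀ e ∈ M₂, e ∈ H.edgeSet)
    (hm₁ : ∀ e ∈ M₁, ∀ f ∈ M₁, ∀ v, v ∈ e → v ∈ f → e = f)
    (hm₂ : ∀ e ∈ M₂, ∀ f ∈ M₂, ∀ v, v ∈ e → v ∈ f → e = f)
    (hd : ∀ e ∈ M₁, ∀ f ∈ M₂, ∀ v, v ∈ e → v ∉ f)
    (hcov : ∀ a b, H.Adj a b → s(a, b) ∈ M₁ ∪ M₂ ∨ a ∈ C₁ ∪ C₂ ∨ b ∈ C₁ ∪ C₂)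
    (hx : x ∈ C₁ ∪ C₂ ∨ ∀ e ∈ M₁ ∪ M₂, x ∉ e) : Good H x := by
  refine ⟨M₁ ∪ M₂, C₁ ∪ C₂, ?_, ?_, ?_, hcov, hx⟩
  · have : Disjoint M₁ M₂ := by
      rw [Finset.disjoint_left]
      intro e h1 h2
      induction e with | _ a b =>
      exact hd _ h1 _ h2 a (by simp) (by simp)
    rw [Finset.card_union_of_disjoint this]
    have := Finset.card_union_le C₁ C₂
    omega
  · intro e he
    rcases Finset.mem_union.1 he with he | he
    · exact hM₁ e he
    · exact hM₂ e he
  · intro e he f hf v hve hvf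
    rcases Finset.mem_union.1 he with he | he <;> rcases Finset.mem_union.1 hf with hf | hf
    · exact hm₁ e he f hf v hve hvf
    · exact absurd hvf (hd e he f hf v hve)
    · exact absurd hve (hd f hf e he v hvf)
    · exact hm₂ e he f hf v hve hvf

lemma exists_adj_of_mem_edge {H : SimpleGraph V} {e : Sym2 V} (he : e ∈ H.edgeSet) {v : V}
    (hv : v ∈ e) : ∃ w, H.Adj v w := by
  obtain ⟨w, rfl⟩ := hv
  exact ⟨w, he⟩

lemma glue [DecidableEq V] {H H₁ H₂ : SimpleGraph V} {x y : V}
    (h₁ : H₁ ≤ H) (h₂ : H₂ ≤ H) (hor : ∀ a b, H.Adj a b → H₁.Adj a b ∨ H₂.Adj a b)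
    (hy : ∀ v a b, H₁.Adj v a → H₂.Adj v b → v = y)
    (hx : x = y ∨ ∀ b, ¬ H₂.Adj x b)
    (g₁ : Good H₁ x) (g₁' : Good (delV H₁ y) x) (g₂ : Good H₂ y) : Good H x := by
  obtain ⟨M₂, C₂, hc₂, hM₂, hm₂, hcov₂, hx₂⟩ := g₂
  rcases hx₂ with hx₂ | hx₂
  · obtain ⟨M₁, C₁, hc₁, hM₁, hm₁, hcov₁, hx₁⟩ := g₁'
    refine Good.of_disjoint (M₁ := M₁) (M₂ := M₂) (C₁ := C₁) (C₂ := C₂) hc₁ hc₂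
      (fun e he => edgeSet_mono ((delV_le _ _).trans h₁) (hM₁ e he))
      (fun e he => edgeSet_mono h₂ (hM₂ e he)) hm₁ hm₂ ?_ ?_ ?_
    · intro e he f hf v hve hvf
      obtain ⟨a, ha⟩ := exists_adj_of_mem_edge (hM₁ e he) hve
      obtain ⟨b, hb⟩ := exists_adj_of_mem_edge (hM₂ f hf) hvf
      exact ha.2.1 (hy v a b ha.1 hb)
    · intro a b hab
      simp only [Finset.mem_union]
      by_cases ha : a = y
      · subst ha; tauto
      by_cases hb : b = y
      · subst hb; tauto
      rcases hor a b hab with h | h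
      · have := hcov₁ a b ⟨h, ha, hb⟩; tauto
      · have := hcov₂ a b h; tauto
    · simp only [Finset.mem_union]
      rcases hx with rfl | hx
      · tauto
      rcases hx₁ with hx₁ | hx₁
      · tauto
      right
      rintro e (he | he) hxe
      · exact hx₁ e he hxe
      · obtain ⟨b, hb⟩ := exists_adj_of_mem_edge (hM₂ e he) hxe
        exact hx b hb
  · obtain ⟨M₁, C₁, hc₁, hM₁, hm₁, hcov₁, hx₁⟩ := g₁
    refine Good.of_disjoint (M₁ := M₁) (M₂ := M₂) (C₁ := C₁) (C₂ := C₂) hc₁ hc₂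
      (fun e he => edgeSet_mono h₁ (hM₁ e he))
      (fun e he => edgeSet_mono h₂ (hM₂ e he)) hm₁ hm₂ ?_ ?_ ?_
    · intro e he f hf v hve hvf
      obtain ⟨a, ha⟩ := exists_adj_of_mem_edge (hM₁ e he) hve
      obtain ⟨b, hb⟩ := exists_adj_of_mem_edge (hM₂ f hf) hvf
      have := hy v a b ha hb
      subst this
      exact hx₂ f hf hvf
    · intro a b hab
      simp only [Finset.mem_union]
      rcases hor a b hab with h | h
      · have := hcov₁ a b h; tauto
      · have := hcov₂ a b h; tauto
    · simp only [Finset.mem_union]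
      rcases hx₁ with hx₁ | hx₁
      · tauto
      right
      rintro e (he | he) hxe
      · exact hx₁ e he hxe
      · rcases hx with rfl | hx
        · exact hx₂ e he hxe
        obtain ⟨b, hb⟩ := exists_adj_of_mem_edge (hM₂ e he) hxe
        exact hx b hb

lemma good2 [DecidableEq V] {H : SimpleGraph V} {p q r s x i j : V} (hpq : H.Adj p q)
    (hrs : H.Adj r s) (hpr : p ≠ r) (hps : p ≠ s) (hqr : q ≠ r) (hqs : q ≠ s)
    (hcov : ∀ a b, H.Adj a b → s(a, b) = s(p, q) ∨ s(a, b) = s(r, s) ∨ a = i ∨ a = j ∨ b = i ∨ b = j)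
    (hx : x = i ∨ x = j ∨ (x ≠ p ∧ x ≠ q ∧ x ≠ r ∧ x ≠ s)) : Good H x := by
  refine ⟨{s(p, q), s(r, s)}, {i, j}, ?_, ?_, ?_, ?_, ?_⟩
  · rw [Finset.card_pair (a := s(p, q)) (b := s(r, s)) (by simp; tauto)]
    exact Finset.card_le_two
  · simp [hpq, hrs]
  · simp only [Finset.mem_insert, Finset.mem_singleton]
    rintro e (rfl | rfl) f (rfl | rfl) v hv hv' <;> first | rfl | (simp at hv hv'; grind)
  · intro a b hab
    have := hcov a b hab
    simp only [Finset.mem_insert, Finset.mem_singleton]; tauto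
  · simp only [Finset.mem_insert, Finset.mem_singleton]
    rcases hx with h | h | h
    · tauto
    · tauto
    · right
      rintro e (rfl | rfl) <;> simp <;> tauto

def Irr (H : SimpleGraph V) : Prop :=
  ∀ (y : V) (S : Set V), y ∉ S → (∀ a ∈ S, ∀ b, H.Adj a b → b ≠ y → b ∈ S) →
    (∃ a ∈ S, ∃ b, H.Adj a b) → ∀ a b, H.Adj a b → a ∈ S ∨ b ∈ S

lemma tri_key_aux [DecidableEq V] {H : SimpleGraph V} (hH : NoOdd H) {a b c d v : V}
    (hab : H.Adj a b) (hbc : H.Adj b c) (hac : H.Adj a c) (had : H.Adj a d)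
    (w : H.Walk d v) (ha : a ∉ w.support) (hb : b ∉ w.support) (hc : c ∉ w.support)
    (hvb : H.Adj v b) : H.Adj d b := by
  have hp := w.bypass_isPath
  have hs := w.support_bypass_subset_support
  generalize w.bypass = p at hp hs
  have ha' : a ∉ p.support := fun h => ha (hs h)
  have hb' : b ∉ p.support := fun h => hb (hs h)
  have hc' : c ∉ p.support := fun h => hc (hs h)
  rcases Nat.eq_zero_or_pos p.length with h0 | h0
  · have := Walk.eq_of_length_eq_zero h0
    subst this; exact hvb
  exfalso
  have hp1 : (p.concat hvb).IsPath := hp.concat hb' hvb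
  rcases Nat.even_or_odd p.length with he | ho
  · refine hH.close ((p.concat hvb).concat hab.symm) (hp1.concat ?_ _) ?_ ?_ had
    · simp [Walk.support_concat, ha', hab.ne]
    · simp; grind
    · simp; grind
  · refine hH.close (((p.concat hvb).concat hbc).concat hac.symm)
      ((hp1.concat ?_ _).concat ?_ _) ?_ ?_ had
    · simp [Walk.support_concat, hc', hbc.ne.symm]
    · simp [Walk.support_concat, ha', hab.ne, hac.ne]
    · simp; omega
    · simp; grind

lemma tri_key [DecidableEq V] {H : SimpleGraph V} (hH : NoOdd H) (hI : Irr H) {a b c d : V}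
    (hab : H.Adj a b) (hbc : H.Adj b c) (hac : H.Adj a c) (had : H.Adj a d)
    (hdb : d ≠ b) (hdc : d ≠ c) : H.Adj d b ∨ H.Adj d c := by
  let S : Set V := {v | ∃ w : H.Walk d v, a ∉ w.support ∧ b ∉ w.support ∧ c ∉ w.support}
  have hdS : d ∈ S := ⟨.nil, by simpa using had.ne, by simpa using hdb.symm, by simpa using hdc.symm⟩
  have hS : ∀ v ∈ S, v ≠ a ∧ v ≠ b ∧ v ≠ c := by
    rintro v ⟨w, h1, h2, h3⟩
    have := w.end_mem_support
    refine ⟨?_, ?_, ?_⟩ <;> rintro rfl <;> contradiction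
  by_contra hn
  push Not at hn
  have := hI a S (fun h => (hS a h).1 rfl) (by
    rintro v ⟨w, h1, h2, h3⟩ u hvu hua
    by_cases hub : u = b
    · subst hub
      exact absurd (tri_key_aux hH hab hbc hac had w h1 h2 h3 hvu) hn.1
    by_cases huc : u = c
    · subst huc
      exact absurd (tri_key_aux hH hac hbc.symm hab had w h1 h3 h2 hvu) hn.2
    refine ⟨w.concat hvu, ?_, ?_, ?_⟩ <;> simp [Walk.support_concat, *] <;> tauto)
    ⟨d, hdS, a, had.symm⟩ b c hbc
  rcases this with h | h
  · exact (hS _ h).2.1 rfl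
  · exact (hS _ h).2.2 rfl

lemma good_book [DecidableEq V] {H : SimpleGraph V} (hH : NoOdd H) {a b c d e x : V}
    (hab : H.Adj a b) (hbc : H.Adj b c) (hac : H.Adj a c)
    (hda : H.Adj d a) (hdb : H.Adj d b) (hdc : d ≠ c)
    (hea : e ≠ a) (heb : e ≠ b) (hec : e ≠ c) (hed : e ≠ d)
    (hT : ∀ u w, H.Adj u w → u ≠ a → u ≠ b → u ≠ c → (H.Adj u a ∧ H.Adj u b) ∨
      (H.Adj u a ∧ H.Adj u c) ∨ (H.Adj u b ∧ H.Adj u c))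
    (heE : ∃ w, H.Adj e w) : Good H x := by
  have key : ∀ z, z ≠ c → z ≠ a → z ≠ b → H.Adj z a → H.Adj z b → ∀ u w, H.Adj u w → u ≠ a → u ≠ b → 
      u ≠ z → H.Adj u a ∧ H.Adj u b := by
    intro z hzc hza hzb h1 h2 u w huw hua hub huz
    by_cases huc : u = c
    · subst huc; exact ⟨hac.symm, hbc.symm⟩
    rcases hT u w huw hua hub huc with h | h | h
    · exact h
    · exact (hH.five (a := u) (b := c) (c := b) (d := z) (e := a) h.2 hbc.symm h2.symm h1 h.1.symm hub huz hzc.symm hac.ne.symm hab.ne.symm).elim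
    · exact (hH.five (a := u) (b := c) (c := a) (d := z) (e := b) h.2 hac.symm h1.symm h2 h.1.symm hua huz hzc.symm hbc.ne.symm hab.ne).elim
  obtain ⟨w, hw⟩ := heE
  obtain ⟨he1, he2⟩ := key d hdc hda.ne hdb.ne hda hdb e w hw hea heb hed
  have page : ∀ u w, H.Adj u w → u ≠ a → u ≠ b → H.Adj u a ∧ H.Adj u b := by
    intro u w huw hua hub
    by_cases hud : u = d
    · subst hud; exact ⟨hda, hdb⟩
    · exact key d hdc hda.ne hdb.ne hda hdb u w huw hua hub hud
  have cov : ∀ u w, H.Adj u w → u = a ∨ u = b ∨ w = a ∨ w = b := by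
    intro u w huw
    by_contra hn
    push Not at hn
    obtain ⟨h1, h2, h3, h4⟩ := hn
    obtain ⟨p1, p2⟩ := page u w huw h1 h2
    obtain ⟨p3, p4⟩ := page w u huw.symm h3 h4
    have : ∃ z, z ≠ u ∧ z ≠ w ∧ z ≠ a ∧ z ≠ b ∧ H.Adj z a ∧ H.Adj z b := by
      by_cases hc : c ≠ u ∧ c ≠ w
      · exact ⟨c, hc.1, hc.2, hac.ne.symm, hbc.ne.symm, hac.symm, hbc.symm⟩
      by_cases hd : d ≠ u ∧ d ≠ w
      · exact ⟨d, hd.1, hd.2, hda.ne, hdb.ne, hda, hdb⟩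
      exact ⟨e, by grind, by grind, hea, heb, he1, he2⟩
    obtain ⟨z, z1, z2, z3, z4, z5, z6⟩ := this
    exact hH.five (a := a) (b := u) (c := w) (d := b) (e := z) p1.symm huw p4 z6.symm z5
      (Ne.symm h3) hab.ne h2 z1.symm z2.symm
  have hne : ∀ p q, p ≠ q → p ≠ a → p ≠ b → q ≠ a → q ≠ b → H.Adj p a → H.Adj q b →
      x ≠ p → x ≠ q → Good H x := by
    intro p q hpq hpa hpb hqa hqb h1 h2 hxp hxq
    refine good2 (i := a) (j := b) h1 h2 hpq hpb hqa.symm hab.ne ?_ ?_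
    · intro u w huw; have := cov u w huw; tauto
    · grind
  by_cases hxc : x = c
  · exact hne d e hed.symm hda.ne hdb.ne hea heb hda he2 (by grind) (by grind)
  by_cases hxd : x = d
  · exact hne c e hec.symm hac.ne.symm hbc.ne.symm hea heb hac.symm he2 (by grind) (by grind)
  · exact hne c d hdc.symm hac.ne.symm hbc.ne.symm hda.ne hdb.ne hac.symm hdb (by grind) (by grind)

lemma good_one [DecidableEq V] {H : SimpleGraph V} {a b c x : V}
    (hbc : H.Adj b c) 
    (hcov : ∀ u w, H.Adj u w → (u = a ∨ u = b ∨ u = c) ∧ (w = a ∨ w = b ∨ w = c))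
    (hx : x ≠ b ∧ x ≠ c) : Good H x := by
  refine ⟨{s(b, c)}, {a}, by simp, by simp [hbc], by grind, ?_, ?_⟩
  · intro u w huw
    have := hcov u w huw
    have := huw.ne
    simp
    grind
  · right; simp; exact hx

lemma good_four [DecidableEq V] {H : SimpleGraph V} {a b c d x : V}
    (hac : H.Adj a c) (hbd : H.Adj b d) (hab : a ≠ b) (hcd : c ≠ d) (had : a ≠ d) (hbc : b ≠ c)
    (hcov : ∀ u w, H.Adj u w → (u = a ∨ u = b ∨ u = c ∨ u = d)) : Good H x := by
  by_cases hx : x = a ∨ x = c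
  · refine good2 (i := a) (j := c) hac hbd hab had hbc.symm hcd ?_ (by tauto)
    intro u w huw
    have h1 := hcov u w huw
    have h2 := hcov w u huw.symm
    have h3 := huw.ne
    simp only [Sym2.eq_iff]
    grind
  · refine good2 (i := b) (j := d) hac hbd hab had hbc.symm hcd ?_ (by grind)
    intro u w huw
    have h1 := hcov u w huw
    have h2 := hcov w u huw.symm
    have h3 := huw.ne
    simp only [Sym2.eq_iff]
    grind

lemma good_tri_extra [DecidableEq V] {H : SimpleGraph V} (hH : NoOdd H) {a b c d x : V}
    (hab : H.Adj a b) (hbc : H.Adj b c) (hac : H.Adj a c)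
    (hda : H.Adj d a) (hdb : H.Adj d b) (hdc : d ≠ c)
    (hT : ∀ u w, H.Adj u w → u ≠ a → u ≠ b → u ≠ c → (H.Adj u a ∧ H.Adj u b) ∨
      (H.Adj u a ∧ H.Adj u c) ∨ (H.Adj u b ∧ H.Adj u c)) : Good H x := by
  by_cases h : ∃ e, e ≠ a ∧ e ≠ b ∧ e ≠ c ∧ e ≠ d ∧ ∃ w, H.Adj e w
  · obtain ⟨e, h1, h2, h3, h4, h5⟩ := h
    exact good_book hH hab hbc hac hda hdb hdc h1 h2 h3 h4 hT h5
  · refine good_four (a := a) (b := b) (c := c) (d := d) hac hdb.symm hab.ne hdc.symm hda.ne.symm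
      hbc.ne ?_
    intro u w huw
    by_contra hn
    exact h ⟨u, by tauto, by tauto, by tauto, by tauto, w, huw⟩

lemma good_tri [DecidableEq V] {H : SimpleGraph V} (hH : NoOdd H) (hI : Irr H) {a b c : V}
    (hab : H.Adj a b) (hbc : H.Adj b c) (hac : H.Adj a c) (x : V) : Good H x := by
  let T : Set V := {u | u = a ∨ u = b ∨ u = c ∨ (H.Adj u a ∧ H.Adj u b) ∨
      (H.Adj u a ∧ H.Adj u c) ∨ (H.Adj u b ∧ H.Adj u c)}
  have hnb : ∀ w, H.Adj a w ∨ H.Adj b w ∨ H.Adj c w → w ∈ T := by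
    intro w hw
    by_cases hwa : w = a
    · exact Or.inl hwa
    by_cases hwb : w = b
    · exact Or.inr (Or.inl hwb)
    by_cases hwc : w = c
    · exact Or.inr (Or.inr (Or.inl hwc))
    simp only [T, Set.mem_ofPred_eq]
    rcases hw with hw | hw | hw
    · have := tri_key hH hI hab hbc hac hw hwb hwc
      have := hw.symm
      tauto
    · have := tri_key hH hI hab.symm hac hbc hw hwa hwc
      have := hw.symm
      tauto
    · have := tri_key hH hI hac.symm hab hbc.symm hw hwa hwb
      have := hw.symm
      tauto
  have hext : ∀ p q u w, H.Adj p q → H.Adj u p → H.Adj u q → H.Adj u w → w = p ∨ w = q ∨ H.Adj p w ∨ H.Adj q w := by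
    intro p q u w hpq h1 h2 huw
    by_cases hp : w = p
    · tauto
    by_cases hq : w = q
    · tauto
    have := tri_key hH hI h1 hpq h2 huw hp hq
    rcases this with h | h
    · exact Or.inr (Or.inr (Or.inl h.symm))
    · exact Or.inr (Or.inr (Or.inr h.symm))
  have haT : a ∈ T := Or.inl rfl
  have hbT : b ∈ T := Or.inr (Or.inl rfl)
  have hcT : c ∈ T := Or.inr (Or.inr (Or.inl rfl))
  have hcl : ∀ u ∈ T, ∀ w, H.Adj u w → w ∈ T := by
    intro u hu w huw
    rcases hu with rfl | rfl | rfl | ⟨h1, h2⟩ | ⟨h1, h2⟩ | ⟨h1, h2⟩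
    · exact hnb w (by tauto)
    · exact hnb w (by tauto)
    · exact hnb w (by tauto)
    · rcases hext _ _ u w hab h1 h2 huw with rfl | rfl | h | h
      · exact haT
      · exact hbT
      · exact hnb w (by tauto)
      · exact hnb w (by tauto)
    · rcases hext _ _ u w hac h1 h2 huw with rfl | rfl | h | h
      · exact haT
      · exact hcT
      · exact hnb w (by tauto)
      · exact hnb w (by tauto)
    · rcases hext _ _ u w hbc h1 h2 huw with rfl | rfl | h | h
      · exact hbT
      · exact hcT
      · exact hnb w (by tauto)
      · exact hnb w (by tauto)
  have hall : ∀ u w, H.Adj u w → u ∈ T := by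
    intro u w huw
    have := hI a (T \ {a}) (by simp) (by
      rintro v ⟨hv, -⟩ z hvz hza
      exact ⟨hcl v hv z hvz, hza⟩) ⟨b, ⟨hbT, hab.ne.symm⟩, c, hbc⟩ u w huw
    rcases this with h | h
    · exact h.1
    · exact hcl w h.1 u huw.symm
  have hT : ∀ u w, H.Adj u w → u ≠ a → u ≠ b → u ≠ c → (H.Adj u a ∧ H.Adj u b) ∨
      (H.Adj u a ∧ H.Adj u c) ∨ (H.Adj u b ∧ H.Adj u c) := by
    intro u w huw h1 h2 h3
    have := hall u w huw
    simp only [T, Set.mem_ofPred_eq] at this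
    tauto
  by_cases h : ∃ d w, H.Adj d w ∧ d ≠ a ∧ d ≠ b ∧ d ≠ c
  · obtain ⟨d, w, hw, h1, h2, h3⟩ := h
    rcases hT d w hw h1 h2 h3 with ⟨p, q⟩ | ⟨p, q⟩ | ⟨p, q⟩
    · exact good_tri_extra hH hab hbc hac p q h3 hT
    · exact good_tri_extra hH hac hbc.symm hab p q h2 (fun u w a1 a2 a3 a4 => by
        have := hT u w a1 a2 a4 a3; tauto)
    · exact good_tri_extra hH hbc hac.symm hab.symm p q h1 (fun u w a1 a2 a3 a4 => by
        have := hT u w a1 a4 a2 a3; tauto)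
  · have h1 : ∀ u w, H.Adj u w → u = a ∨ u = b ∨ u = c := by
      intro u w huw
      by_contra hn
      exact h ⟨u, w, huw, by tauto, by tauto, by tauto⟩
    have h2 : ∀ u w, H.Adj u w → (u = a ∨ u = b ∨ u = c) ∧ (w = a ∨ w = b ∨ w = c) :=
      fun u w huw => ⟨h1 u w huw, h1 w u huw.symm⟩
    have := hab.ne
    have := hbc.ne
    have := hac.ne
    by_cases hxb : x = b
    · exact good_one (a := b) (b := a) (c := c) hac (by grind) (by grind)
    by_cases hxc : x = c
    · exact good_one (a := c) (b := a) (c := b) hab (by grind) (by grind)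
    exact good_one (a := a) (b := b) (c := c) hbc (by grind) (by grind)

def touch (H : SimpleGraph V) (S : Set V) : SimpleGraph V where
  Adj a b := H.Adj a b ∧ (a ∈ S ∨ b ∈ S)
  symm := ⟨fun _ _ h => ⟨h.1.symm, h.2.symm⟩⟩
  loopless := ⟨fun _ h => h.1.ne rfl⟩

def avoid (H : SimpleGraph V) (S : Set V) : SimpleGraph V where
  Adj a b := H.Adj a b ∧ a ∉ S ∧ b ∉ S
  symm := ⟨fun _ _ h => ⟨h.1.symm, h.2.symm⟩⟩
  loopless := ⟨fun _ h => h.1.ne rfl⟩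

theorem good_all [Fintype V] [DecidableEq V] (H : SimpleGraph V) (hH : NoOdd H) (x : V) :
    Good H x := by
  induction H using WellFoundedLT.induction generalizing x with
  | _ H ih =>
  by_cases hI : Irr H
  · rcases bip_or_triangle hH with ⟨⟨c⟩⟩ | ⟨a, b, c, h1, h2, h3⟩
    · exact good_bip c x
    · exact good_tri hH hI h1 h2 h3 x
  unfold Irr at hI
  push Not at hI
  obtain ⟨y, S, hyS, hcl, ⟨p, hpS, q, hpq⟩, u, w, huw, huS, hwS⟩ := hI
  have l1 : touch H S < H := by
    refine lt_of_le_of_ne (fun _ _ h => h.1) (fun h => ?_)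
    have h2 : (touch H S).Adj u w := by rw [h]; exact huw
    exact h2.2.elim huS hwS
  have l2 : avoid H S < H := by
    refine lt_of_le_of_ne (fun _ _ h => h.1) (fun h => ?_)
    have h2 : (avoid H S).Adj p q := by rw [h]; exact hpq
    exact h2.2.1 hpS
  have hor : ∀ a b, H.Adj a b → (touch H S).Adj a b ∨ (avoid H S).Adj a b := by
    intro a b hab
    by_cases h : a ∈ S ∨ b ∈ S
    · exact Or.inl ⟨hab, h⟩
    · push Not at h
      exact Or.inr ⟨hab, h⟩
  have hy : ∀ v a b, (touch H S).Adj v a → (avoid H S).Adj v b → v = y := by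
    intro v a b h1 h2
    by_contra hn
    have hv : v ∉ S := h2.2.1
    exact hv (hcl a (h1.2.resolve_left hv) v h1.1.symm hn)
  have G : ∀ K, K < H → ∀ x, Good K x := fun K hK x => ih K hK (hH.mono hK.le) x
  by_cases hx : x = y ∨ ∀ b, ¬ (avoid H S).Adj x b
  · exact glue l1.le l2.le hor hy hx (G _ l1 _) (G _ ((delV_le _ _).trans_lt l1) _) (G _ l2 _)
  · push Not at hx
    obtain ⟨hxy, b, hb⟩ := hx
    refine glue l2.le l1.le (fun a b h => (hor a b h).symm) (fun v a b h1 h2 => hy v b a h2 h1)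
      (Or.inr ?_) (G _ l2 _) (G _ ((delV_le _ _).trans_lt l2) _) (G _ l1 y)
    intro c hc
    exact hxy (hy x c b hc hb)

def NoWheel (G : SimpleGraph V) : Prop :=
  ¬ ∃ (n : ℕ) (h u : V) (w : G.Walk u u),
      Odd n ∧ 5 ≤ n ∧ w.IsCycle ∧ w.length = n ∧ ∀ x ∈ w.support, G.Adj h x

lemma NoWheel.mono {G K : SimpleGraph V} (h : G ≤ K) (hK : NoWheel K) : NoWheel G := by
  rintro ⟨n, x, u, w, h1, h2, h3, h4, h5⟩
  exact hK ⟨n, x, u, w.mapLe h, h1, h2, h3.mapLe h, by simpa using h4, fun y hy =>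
    h (h5 y (by simpa using hy))⟩

def linkG (G : SimpleGraph V) (v : V) : SimpleGraph V where
  Adj a b := G.Adj a b ∧ G.Adj v a ∧ G.Adj v b
  symm := ⟨fun _ _ h => ⟨h.1.symm, h.2.2, h.2.1⟩⟩
  loopless := ⟨fun _ h => h.1.ne rfl⟩

lemma linkG_le (G : SimpleGraph V) (v : V) : linkG G v ≤ G := fun _ _ h => h.1

lemma linkG_noOdd {G : SimpleGraph V} (hG : NoWheel G) (v : V) : NoOdd (linkG G v) := by
  intro u w hw ho
  by_contra hn
  refine hG ⟨w.length, v, u, w.mapLe (linkG_le G v), ho, by omega, hw.mapLe _, by simp, ?_⟩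
  intro x hx
  have hx : x ∈ w.support := by simpa using hx
  have : ∃ e ∈ w.edges, x ∈ e := (Walk.mem_support_iff_exists_mem_edges_of_not_nil hw.not_nil).1 hx
  obtain ⟨e, he, hxe⟩ := this
  obtain ⟨y, hy⟩ := exists_adj_of_mem_edge (w.edges_subset_edgeSet he) hxe
  exact hy.2.1

def restG (G : SimpleGraph V) (v : V) (M : Finset (Sym2 V)) : SimpleGraph V where
  Adj a b := G.Adj a b ∧ a ≠ v ∧ b ≠ v ∧ s(a, b) ∉ M
  symm := ⟨fun _ _ h => ⟨h.1.symm, h.2.2.1, h.2.1, by rw [Sym2.eq_swap]; exact h.2.2.2⟩⟩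
  loopless := ⟨fun _ h => h.1.ne rfl⟩

theorem tuza_core [Fintype V] [DecidableEq V] (G : SimpleGraph V) (hG : NoWheel G) :
    ∃ (S : Finset (Finset V)) (Y : Finset (Sym2 V)), EdgeDisjointTriangles G S ∧
      ↑Y ⊆ G.edgeSet ∧ (∀ a b c, G.Adj a b → G.Adj a c → G.Adj b c →
        s(a, b) ∈ Y ∨ s(a, c) ∈ Y ∨ s(b, c) ∈ Y) ∧ Y.card ≤ 2 * S.card := by
  classical
  induction G using WellFoundedLT.induction with
  | _ G ih =>
  by_cases hb : ∃ v w, G.Adj v w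
  swap
  · push Not at hb
    exact ⟨∅, ∅, ⟨fun t ht => absurd ht (Finset.notMem_empty t), fun t ht => absurd ht (Finset.notMem_empty t)⟩, by simp, fun a b _ h => (hb a b h).elim, by simp⟩
  obtain ⟨v, v', hvv⟩ := hb
  obtain ⟨M, C, hc, hM, hm, hcov, -⟩ := good_all (linkG G v) (linkG_noOdd hG v) v
  have hle : restG G v M ≤ G := fun _ _ h => h.1
  have hlt : restG G v M < G := by
    refine lt_of_le_of_ne hle (fun h => ?_)
    have h2 : (restG G v M).Adj v v' := by rw [h]; exact hvv
    exact h2.2.1 rfl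
  obtain ⟨S, Y, ⟨hS1, hS2⟩, hY, hYc, hcard⟩ := ih _ hlt (hG.mono hle)
  -- facts on old triangles
  have hSv : ∀ t ∈ S, v ∉ t := by
    intro t ht hv
    have hcl := hS1 t ht
    have : 1 < t.card := by rw [hcl.card_eq]; norm_num
    obtain ⟨w, hw, hwv⟩ := Finset.exists_mem_ne this v
    exact (hcl.isClique hv hw hwv.symm).2.1 rfl
  have hMl : ∀ a b, s(a, b) ∈ M → G.Adj a b ∧ G.Adj v a ∧ G.Adj v b := fun a b h => hM _ h
  have hMv : ∀ e ∈ M, v ∉ e := by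
    intro e he hv
    obtain ⟨w, hw⟩ := exists_adj_of_mem_edge (hM e he) hv
    exact hw.2.1.ne rfl
  let T : Sym2 V → Finset V := fun e => insert v e.toFinset
  have hTm : ∀ e x, x ∈ T e ↔ x = v ∨ x ∈ e := by intro e x; simp [T]
  have hint : ∀ e ∈ M, ∀ f ∈ M, e ≠ f → T e ∩ T f ⊆ {v} := by
    intro e he f hf hef x hx
    rw [Finset.mem_inter, hTm, hTm] at hx
    rw [Finset.mem_singleton]
    by_contra hn
    exact hef (hm e he f hf x (hx.1.resolve_left hn) (hx.2.resolve_left hn))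
  have hinj : Set.InjOn T M := by
    intro e he f hf hef
    by_contra hn
    have h1 := hint e he f hf hn
    rw [← hef, Finset.inter_self] at h1
    induction e with | _ a b =>
    have h2 := h1 ((hTm s(a, b) a).2 (by simp))
    rw [Finset.mem_singleton] at h2
    exact hMv _ he (by simp [h2])
  have hdisj : Disjoint S (M.image T) := by
    rw [Finset.disjoint_left]
    intro t ht ht'
    obtain ⟨e, -, rfl⟩ := Finset.mem_image.1 ht'
    exact hSv _ ht (by simp [T])
  have hold : ∀ t ∈ S, ∀ e ∈ M, (t ∩ T e).card ≤ 1 := by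
    intro t ht e he
    rw [Finset.card_le_one]
    intro a ha b hb
    rw [Finset.mem_inter, hTm] at ha hb
    by_contra hab
    have ha' := ha.2.resolve_left (fun h => hSv t ht (h ▸ ha.1))
    have hb' := hb.2.resolve_left (fun h => hSv t ht (h ▸ hb.1))
    have := (Sym2.mem_and_mem_iff hab).1 ⟨ha', hb'⟩
    subst this
    exact ((hS1 t ht).isClique ha.1 hb.1 hab).2.2.2 he
  refine ⟨S ∪ M.image T, Y ∪ M ∪ (C.filter (G.Adj v)).image (fun c => s(v, c)), ⟨?_, ?_⟩, ?_, ?_, ?_⟩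
  · intro t ht
    rcases Finset.mem_union.1 ht with ht | ht
    · exact (hS1 t ht).mono hle
    · obtain ⟨e, he, rfl⟩ := Finset.mem_image.1 ht
      induction e with | _ a b =>
      obtain ⟨h1, h2, h3⟩ := hMl a b he
      have : T s(a, b) = {v, a, b} := by ext x; rw [hTm]; simp
      rw [this]
      exact is3Clique_triple_iff.2 ⟨h2, h3, h1⟩
  · intro t₁ h₁ t₂ h₂ hne
    rcases Finset.mem_union.1 h₁ with h₁ | h₁ <;> rcases Finset.mem_union.1 h₂ with h₂ | h₂
    · exact hS2 _ h₁ _ h₂ hne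
    · obtain ⟨e, he, rfl⟩ := Finset.mem_image.1 h₂
      exact hold _ h₁ e he
    · obtain ⟨e, he, rfl⟩ := Finset.mem_image.1 h₁
      rw [Finset.inter_comm]
      exact hold _ h₂ e he
    · obtain ⟨e, he, rfl⟩ := Finset.mem_image.1 h₁
      obtain ⟨f, hf, rfl⟩ := Finset.mem_image.1 h₂
      exact (Finset.card_le_card (hint e he f hf (fun h => hne (by rw [h])))).trans (by simp)
  · intro e he
    rw [Finset.mem_coe, Finset.mem_union, Finset.mem_union] at he
    rcases he with (he | he) | he
    · exact edgeSet_mono hle (hY he)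
    · exact edgeSet_mono (linkG_le G v) (hM e he)
    · obtain ⟨c, hc, rfl⟩ := Finset.mem_image.1 he
      exact (Finset.mem_filter.1 hc).2
  · have hv : ∀ a b, G.Adj v a → G.Adj v b → G.Adj a b → s(a, b) ∈ M ∨
        s(v, a) ∈ (C.filter (G.Adj v)).image (fun c => s(v, c)) ∨
        s(v, b) ∈ (C.filter (G.Adj v)).image (fun c => s(v, c)) := by
      intro a b h1 h2 h3
      rcases hcov a b ⟨h3, h1, h2⟩ with h | h | h
      · exact Or.inl h
      · exact Or.inr (Or.inl (Finset.mem_image_of_mem _ (Finset.mem_filter.2 ⟨h, h1⟩)))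
      · exact Or.inr (Or.inr (Finset.mem_image_of_mem _ (Finset.mem_filter.2 ⟨h, h2⟩)))
    intro a b c hab hac hbc
    simp only [Finset.mem_union]
    by_cases ha : a = v
    · subst ha
      have := hv b c hab hac hbc
      tauto
    by_cases hb : b = v
    · subst hb
      have := hv a c hab.symm hbc hac
      rw [Sym2.eq_swap (a := a) (b := b)]
      tauto
    by_cases hc : c = v
    · subst hc
      have := hv a b hac.symm hbc.symm hab
      rw [Sym2.eq_swap (a := a) (b := c), Sym2.eq_swap (a := b) (b := c)]
      tauto
    by_cases h1 : s(a, b) ∈ M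
    · tauto
    by_cases h2 : s(a, c) ∈ M
    · tauto
    by_cases h3 : s(b, c) ∈ M
    · tauto
    have := hYc a b c ⟨hab, ha, hb, h1⟩ ⟨hac, ha, hc, h2⟩ ⟨hbc, hb, hc, h3⟩
    tauto
  · rw [Finset.card_union_of_disjoint hdisj, Finset.card_image_of_injOn hinj]
    have h1 := Finset.card_union_le (Y ∪ M) ((C.filter (G.Adj v)).image (fun c => s(v, c)))
    have h2 := Finset.card_union_le Y M
    have h3 : ((C.filter (G.Adj v)).image (fun c => s(v, c))).card ≤ C.card :=
      Finset.card_image_le.trans (Finset.card_filter_le _ _)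
    omega


/-- If a finite graph `G` has no subgraph isomorphic to the wheel `Wₙ` for any odd
`n ≥ 5` (that is, there is no cycle of odd length `n ≥ 5` all of whose vertices are
adjacent to a common vertex), then τ(G) ≤ 2ν(G). -/
theorem tuza_of_no_odd_wheel [Fintype V] [DecidableEq V] (G : SimpleGraph V)
    (hwheel : ¬ ∃ (n : ℕ) (h u : V) (w : G.Walk u u),
      Odd n ∧ 5 ≤ n ∧ w.IsCycle ∧ w.length = n ∧ ∀ x ∈ w.support, G.Adj h x) :
    triTau G ≤ 2 * triNu G := by
  obtain ⟨S, Y, hS, hY, hYc, hcard⟩ := tuza_core G hwheel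
  have h1 : triTau G ≤ Y.card := by
    refine Nat.sInf_le ⟨Y, hY, ?_, rfl⟩
    intro t ht
    obtain ⟨a, b, c, h1, h2, h3, rfl⟩ := is3Clique_iff.1 ht
    rw [deleteEdges_adj] at h1 h2 h3
    have := hYc a b c h1.1 h2.1 h3.1
    have := h1.2
    have := h2.2
    have := h3.2
    simp only [Finset.mem_coe] at *
    tauto
  have h2 : S.card ≤ triNu G := by
    refine le_csSup ⟨Fintype.card (Finset V), ?_⟩ ⟨S, hS, rfl⟩
    rintro n ⟨S', -, rfl⟩
    exact Finset.card_le_univ S'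
  omega
end

section
/- Let G be a finite simple robust graph, and let v ∈ V(G) with degree d(v) ≤ 6. If the complement of G[N(v)] has maximum degree greater than 1, then {v} is a reducible vertex set in G. Also, if d(v) ≤ 6 and the complement of G[N(v)] has exactly 2 edges, then {v} is a reducible vertex set in G. -/
open SimpleGraph

variable {V : Type*}

/-- `G` is robust: for every vertex `v`, every connected component of the subgraph induced
by the neighborhood of `v` has at least 5 vertices. -/
def Robust (G : SimpleGraph V) : Prop :=
  ∀ (v : V) (c : (G.induce (G.neighborSet v)).ConnectedComponent), 5 ≤ c.supp.ncard

/-- `V₀` is a reducible vertex set of `G`. -/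
def ReducibleVertexSet [DecidableEq V] (G : SimpleGraph V) (V₀ : Finset V) : Prop :=
  V₀.Nonempty ∧
    ∃ (S : Finset (Finset V)) (X : Finset (Sym2 V)),
      EdgeDisjointTriangles G S ∧ ↑X ⊆ G.edgeSet ∧ X.card ≤ 2 * S.card ∧
      (∀ t : Finset V, (G.deleteEdges ↑X).IsNClique 3 t → ∀ x ∈ V₀, x ∉ t) ∧
      (∀ t ∈ S, ∀ u ∈ t, ∀ v ∈ t, u ≠ v → u ∉ V₀ → v ∉ V₀ → s(u, v) ∈ X)

theorem cm_crit [DecidableEq V] (G : SimpleGraph V) {m : ℕ} (f : Fin (m + 1) → V)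
    (hf : Function.Injective f)
    (hr : ∀ w, G.Adj (f 0) w ↔ ∃ i, i ≠ 0 ∧ f i = w)
    (S : Finset (Finset (Fin (m + 1)))) (X : Finset (Sym2 (Fin (m + 1))))
    (h3 : ∀ t ∈ S, t.card = 3)
    (hdis : ∀ t₁ ∈ S, ∀ t₂ ∈ S, t₁ ≠ t₂ → (t₁ ∩ t₂).card ≤ 1)
    (hcard : X.card ≤ 2 * S.card)
    (hdiag : ∀ a, s(a, a) ∉ X)
    (hS : ∀ t ∈ S, ∀ u ∈ t, ∀ w ∈ t, u ≠ w → u ≠ 0 → w ≠ 0 → s(u, w) ∈ X)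
    (d1 : ∀ a b, a ≠ 0 → b ≠ 0 → s(a, b) ∈ X → G.Adj (f a) (f b))
    (d2 : ∀ a b, a ≠ 0 → b ≠ 0 → G.Adj (f a) (f b) → s(a, b) ∈ X ∨ s(0, a) ∈ X ∨ s(0, b) ∈ X) :
    ReducibleVertexSet G {f 0} := by
  classical
  let F : Fin (m + 1) ↪ V := ⟨f, hf⟩
  have hadj0 : ∀ i, i ≠ 0 → G.Adj (f 0) (f i) := fun i hi => (hr _).2 ⟨i, hi, rfl⟩
  have hSadj : ∀ t ∈ S, ∀ u ∈ t, ∀ w ∈ t, u ≠ w → G.Adj (f u) (f w) := by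
    intro t ht u hu w hw huw
    by_cases hu0 : u = 0
    · subst hu0
      exact hadj0 _ (Ne.symm huw)
    · by_cases hw0 : w = 0
      · subst hw0
        exact (hadj0 _ hu0).symm
      · exact d1 _ _ hu0 hw0 (hS t ht u hu w hw huw hu0 hw0)
  have hX : ∀ a b, s(a, b) ∈ X → G.Adj (f a) (f b) := by
    intro a b h
    have hab : a ≠ b := by rintro rfl; exact hdiag a h
    by_cases ha0 : a = 0
    · subst ha0
      exact hadj0 _ (Ne.symm hab)
    · by_cases hb0 : b = 0
      · subst hb0
        exact (hadj0 _ ha0).symm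
      · exact d1 _ _ ha0 hb0 h
  have hmem : ∀ a b, s(a, b) ∈ X → s(f a, f b) ∈ X.map F.sym2Map := by
    intro a b h
    exact Finset.mem_map.2 ⟨s(a, b), h, rfl⟩
  refine ⟨Finset.singleton_nonempty _, S.map (Finset.mapEmbedding F).toEmbedding,
    X.map F.sym2Map, ⟨?_, ?_⟩, ?_, ?_, ?_, ?_⟩
  · intro t ht
    obtain ⟨t, ht', rfl⟩ := Finset.mem_map.1 ht
    refine ⟨?_, ?_⟩
    · intro a ha b hb hab
      obtain ⟨a, ha', rfl⟩ := Finset.mem_map.1 (show a ∈ t.map F from ha)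
      obtain ⟨b, hb', rfl⟩ := Finset.mem_map.1 (show b ∈ t.map F from hb)
      exact hSadj t ht' a ha' b hb' (by rintro rfl; exact hab rfl)
    · exact (Finset.card_map _).trans (h3 t ht')
  · intro t₁ h₁ t₂ h₂ hne
    obtain ⟨t₁, h₁', rfl⟩ := Finset.mem_map.1 h₁
    obtain ⟨t₂, h₂', rfl⟩ := Finset.mem_map.1 h₂
    change (t₁.map F ∩ t₂.map F).card ≤ 1
    rw [← Finset.map_inter, Finset.card_map]
    exact hdis _ h₁' _ h₂' (by rintro rfl; exact hne rfl)
  · intro e he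
    obtain ⟨e, he', rfl⟩ := Finset.mem_map.1 (Finset.mem_coe.1 he)
    induction e with
    | _ a b => exact hX a b he'
  · simpa using hcard
  · intro t ht x hx hxt
    rw [Finset.mem_singleton] at hx
    subst hx
    have hcl := ht.1
    obtain ⟨p, q, hp, hq, hpq, hp0, hq0⟩ : ∃ p q, p ∈ t ∧ q ∈ t ∧ p ≠ q ∧ p ≠ f 0 ∧ q ≠ f 0 := by
      have h2 : 1 < (t.erase (f 0)).card := by
        rw [Finset.card_erase_of_mem hxt, ht.2]; norm_num
      obtain ⟨p, hp, q, hq, hpq⟩ := Finset.one_lt_card.1 h2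
      simp only [Finset.mem_erase] at hp hq
      exact ⟨p, q, hp.2, hq.2, hpq, hp.1, hq.1⟩
    have e1 := SimpleGraph.deleteEdges_adj.1 (hcl (Finset.mem_coe.2 hxt) hp (Ne.symm hp0))
    have e2 := SimpleGraph.deleteEdges_adj.1 (hcl (Finset.mem_coe.2 hxt) hq (Ne.symm hq0))
    have e3 := SimpleGraph.deleteEdges_adj.1 (hcl hp hq hpq)
    obtain ⟨i, hi, rfl⟩ := (hr _).1 e1.1
    obtain ⟨j, hj, rfl⟩ := (hr _).1 e2.1
    rcases d2 i j hi hj e3.1 with h | h | h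
    · exact e3.2 (hmem _ _ h)
    · exact e1.2 (hmem _ _ h)
    · exact e2.2 (hmem _ _ h)
  · intro t ht a ha b hb hab ha0 hb0
    obtain ⟨t, ht', rfl⟩ := Finset.mem_map.1 ht
    obtain ⟨a, ha', rfl⟩ := Finset.mem_map.1 (show a ∈ t.map F from ha)
    obtain ⟨b, hb', rfl⟩ := Finset.mem_map.1 (show b ∈ t.map F from hb)
    rw [Finset.mem_singleton] at ha0 hb0
    exact hmem _ _ (hS t ht' a ha' b hb' (by rintro rfl; exact hab rfl)
      (by rintro rfl; exact ha0 rfl) (by rintro rfl; exact hb0 rfl))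

def cmS {m : ℕ} (M : List (Fin (m + 1) × Fin (m + 1))) : Finset (Finset (Fin (m + 1))) :=
  (M.map fun q => {0, q.1, q.2}).toFinset

def cmX {m : ℕ} (M : List (Fin (m + 1) × Fin (m + 1))) (A : List (Fin (m + 1))) :
    Finset (Sym2 (Fin (m + 1))) :=
  (M.map fun q => s(q.1, q.2)).toFinset ∪ (A.map fun a => s(0, a)).toFinset

def cmStat {m : ℕ} (S : Finset (Finset (Fin (m + 1)))) (X : Finset (Sym2 (Fin (m + 1)))) : Prop :=
  (∀ t ∈ S, t.card = 3) ∧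
  (∀ t₁ ∈ S, ∀ t₂ ∈ S, t₁ ≠ t₂ → (t₁ ∩ t₂).card ≤ 1) ∧
  X.card ≤ 2 * S.card ∧ (∀ a, s(a, a) ∉ X) ∧
  (∀ t ∈ S, ∀ u ∈ t, ∀ w ∈ t, (u = w ∨ u = 0 ∨ w = 0 ∨ s(u, w) ∈ X))

instance {m : ℕ} (S : Finset (Finset (Fin (m + 1)))) (X : Finset (Sym2 (Fin (m + 1)))) :
    Decidable (cmStat S X) := by
  have i1 : Decidable (∀ t ∈ S, t.card = 3) := inferInstance
  have i2 : Decidable (∀ t₁ ∈ S, ∀ t₂ ∈ S, t₁ ≠ t₂ → (t₁ ∩ t₂).card ≤ 1) := inferInstance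
  have i3 : Decidable (∀ a, s(a, a) ∉ X) := inferInstance
  have i4 : Decidable (∀ t ∈ S, ∀ u ∈ t, ∀ w ∈ t, (u = w ∨ u = 0 ∨ w = 0 ∨ s(u, w) ∈ X)) :=
    inferInstance
  unfold cmStat; infer_instance

def cmChk {α β : Type} (tab : List (ℕ × ℕ × α)) (cuts : List (ℕ × β)) (e : ℕ) : Bool :=
  tab.any (fun c => Nat.beq (Nat.land e c.1) c.1 && Nat.beq (Nat.land e c.2.1) 0) ||
    cuts.any (fun c => Nat.beq (Nat.land e c.1) 0)

def cmAll (P : ℕ → Bool) : ℕ → ℕ → Bool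
  | 0, acc => P acc
  | k + 1, acc => cmAll P k (2 * acc) && cmAll P k (2 * acc + 1)

theorem cmAll_spec (P : ℕ → Bool) (k acc : ℕ) (h : cmAll P k acc = true) :
    ∀ e < 2 ^ k, P (acc * 2 ^ k + e) = true := by
  induction k generalizing acc with
  | zero =>
    intro e he
    have : e = 0 := by simpa using he
    subst this
    simpa [cmAll] using h
  | succ k ih =>
    intro e he
    simp only [cmAll, Bool.and_eq_true] at h
    rw [pow_succ] at he ⊢
    by_cases hk : e < 2 ^ k
    · have := ih _ h.1 e hk
      rwa [show acc * (2 ^ k * 2) + e = 2 * acc * 2 ^ k + e by ring]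
    · have := ih _ h.2 (e - 2 ^ k) (by omega)
      rwa [show acc * (2 ^ k * 2) + e = (2 * acc + 1) * 2 ^ k + (e - 2 ^ k) by
        obtain ⟨d, rfl⟩ := Nat.exists_eq_add_of_le (not_lt.1 hk)
        rw [Nat.add_sub_cancel_left]; ring]

theorem cm_main [DecidableEq V] (G : SimpleGraph V) {m K : ℕ} (f : Fin (m + 1) → V)
    (hf : Function.Injective f)
    (hr : ∀ w, G.Adj (f 0) w ↔ ∃ i, i ≠ 0 ∧ f i = w)
    (p : Fin K → Fin (m + 1) × Fin (m + 1))
    (hp : ∀ a b, a ≠ 0 → b ≠ 0 → G.Adj (f a) (f b) → ∃ k, p k = (a, b) ∨ p k = (b, a))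
    (tab : List (ℕ × ℕ × List (Fin (m + 1) × Fin (m + 1)) × List (Fin (m + 1))))
    (cuts : List (ℕ × List (Fin (m + 1))))
    (htab : ∀ c ∈ tab, cmStat (cmS c.2.2.1) (cmX c.2.2.1 c.2.2.2) ∧
      (∀ a b, a ≠ 0 → b ≠ 0 → s(a, b) ∈ cmX c.2.2.1 c.2.2.2 →
        ∃ k, (p k = (a, b) ∨ p k = (b, a)) ∧ c.1.testBit k = true) ∧
      (∀ k : Fin K, c.2.1.testBit k = true ∨ s((p k).1, (p k).2) ∈ cmX c.2.2.1 c.2.2.2 ∨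
        s(0, (p k).1) ∈ cmX c.2.2.1 c.2.2.2 ∨ s(0, (p k).2) ∈ cmX c.2.2.1 c.2.2.2))
    (hcuts : ∀ c ∈ cuts, 0 ∉ c.2 ∧ (∃ i, i ∈ c.2) ∧ (∃ i, i ≠ 0 ∧ i ∉ c.2) ∧
      ∀ k, (¬ ((p k).1 ∈ c.2 ↔ (p k).2 ∈ c.2)) → c.1.testBit k = true)
    (hall : cmAll (cmChk tab cuts) K 0 = true)
    (hconn : ∀ C : List (Fin (m + 1)), 0 ∉ C → (∃ i, i ∈ C) → (∃ i, i ≠ 0 ∧ i ∉ C) →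
      ∃ a b, a ∈ C ∧ b ∉ C ∧ b ≠ 0 ∧ G.Adj (f a) (f b)) :
    ReducibleVertexSet G {f 0} := by
  classical
  let e : ℕ := Nat.ofBits (fun k : Fin K => decide (G.Adj (f (p k).1) (f (p k).2)))
  have he : ∀ k : Fin K, e.testBit k = decide (G.Adj (f (p k).1) (f (p k).2)) := by
    intro k
    exact Nat.testBit_ofBits_lt _ _ k.2
  have hlt : e < 2 ^ K := Nat.ofBits_lt_two_pow _
  have := cmAll_spec _ _ _ hall e hlt
  rw [zero_mul, zero_add] at this
  have hand : ∀ a : ℕ, Nat.land e a = e &&& a := fun a => rfl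
  simp only [cmChk, Bool.or_eq_true, List.any_eq_true, Bool.and_eq_true, Nat.beq_eq, hand] at this
  rcases this with ⟨c, hc, h1, h2⟩ | ⟨c, hc, h1⟩
  · obtain ⟨⟨s1, s2, s3, s4, s5⟩, t1, t2⟩ := htab c hc
    refine cm_crit G f hf hr _ _ s1 s2 s3 s4
      (fun t ht u hu w hw => by have := s5 t ht u hu w hw; tauto) ?_ ?_
    · intro a b ha hb hab
      obtain ⟨k, hk, hkb⟩ := t1 a b ha hb hab
      have := congrArg (fun x => Nat.testBit x k) h1
      simp only [Nat.testBit_and, hkb, he, Bool.and_true, decide_eq_true_eq] at this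
      rcases hk with hk | hk
      · simpa [hk] using this
      · simpa [hk] using this.symm
    · intro a b ha hb hab
      obtain ⟨k, hk⟩ := hp a b ha hb hab
      have := congrArg (fun x => Nat.testBit x k) h2
      simp only [Nat.testBit_and, he, Nat.zero_testBit] at this
      have hadj : G.Adj (f (p k).1) (f (p k).2) := by
        rcases hk with hk | hk
        · simpa [hk] using hab
        · simpa [hk] using hab.symm
      have h3 := t2 k
      rw [decide_eq_true hadj, Bool.true_and] at this
      rw [this] at h3
      rcases hk with hk | hk
      · simpa [hk] using h3
      · rw [hk, Sym2.eq_swap] at h3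
        simp only [Bool.false_eq_true, false_or] at h3
        tauto
  · obtain ⟨c0, c1, c2, c3⟩ := hcuts c hc
    obtain ⟨a, b, ha, hb, hb0, hab⟩ := hconn c.2 c0 c1 c2
    have ha0 : a ≠ 0 := by rintro rfl; exact c0 ha
    obtain ⟨k, hk⟩ := hp a b ha0 hb0 hab
    have := congrArg (fun x => Nat.testBit x k) h1
    have hadj : G.Adj (f (p k).1) (f (p k).2) := by
      rcases hk with hk | hk
      · simpa [hk] using hab
      · simpa [hk] using hab.symm
    have hkb := c3 k (by rcases hk with hk | hk <;> simp [hk, ha, hb])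
    simp only [Nat.testBit_and, he, Nat.zero_testBit, hkb, decide_eq_true hadj] at this
    simp at this

def pr5 : Fin 8 → Fin 6 × Fin 6 :=
  ![(2, 3), (1, 4), (2, 4), (3, 4), (1, 5), (2, 5), (3, 5), (4, 5)]
def tab5 : List (ℕ × ℕ × List (Fin 6 × Fin 6) × List (Fin 6)) := [
  (3, 0, [(2, 3), (1, 4)], [4, 5]),
  (17, 0, [(2, 3), (1, 5)], [4, 5]),
  (34, 1, [(1, 4), (2, 5)], [4, 5]),
  (20, 1, [(2, 4), (1, 5)], [4, 5]),
  (2, 113, [(1, 4)], [4]),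
  (8, 7, [(3, 4)], [5]),
  (16, 15, [(1, 5)], [5]),
  (64, 49, [(3, 5)], [4])]
def cut5 : List (ℕ × List (Fin 6)) := [
  (18, [1]),
  (37, [1, 3, 4, 5])]

def pr6 : Fin 13 → Fin 7 × Fin 7 :=
  ![(2, 3), (1, 4), (2, 4), (3, 4), (1, 5), (2, 5), (3, 5), (4, 5), (1, 6), (2, 6), (3, 6), (4, 6), (5, 6)]
def tab6 : List (ℕ × ℕ × List (Fin 7 × Fin 7) × List (Fin 7)) := [
  (4099, 0, [(2, 3), (1, 4), (5, 6)], [4, 5, 6]),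
  (2065, 0, [(2, 3), (1, 5), (4, 6)], [4, 5, 6]),
  (385, 0, [(2, 3), (4, 5), (1, 6)], [4, 5, 6]),
  (324, 1, [(2, 4), (3, 5), (1, 6)], [4, 5, 6]),
  (536, 1, [(3, 4), (1, 5), (2, 6)], [4, 5, 6]),
  (578, 16, [(1, 4), (3, 5), (2, 6)], [2, 4, 6]),
  (1044, 256, [(2, 4), (1, 5), (3, 6)], [2, 4, 5]),
  (296, 2, [(3, 4), (2, 5), (1, 6)], [2, 5, 6]),
  (3, 12, [(2, 3), (1, 4)], [5, 6]),
  (1044, 64, [(2, 4), (1, 5), (3, 6)], [2, 4, 6]),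
  (296, 1024, [(3, 4), (2, 5), (1, 6)], [2, 4, 5]),
  (66, 13, [(1, 4), (3, 5)], [5, 6]),
  (514, 113, [(1, 4), (2, 6)], [4, 6]),
  (20, 1793, [(2, 4), (1, 5)], [4, 5]),
  (528, 15, [(1, 5), (2, 6)], [5, 6]),
  (324, 2, [(2, 4), (3, 5), (1, 6)], [3, 5, 6]),
  (536, 256, [(3, 4), (1, 5), (2, 6)], [3, 4, 5]),
  (260, 113, [(2, 4), (1, 6)], [4, 6]),
  (288, 15, [(2, 5), (1, 6)], [5, 6]),
  (1058, 16, [(1, 4), (2, 5), (3, 6)], [3, 4, 6]),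
  (17, 96, [(2, 3), (1, 5)], [4, 6]),
  (40, 1793, [(3, 4), (2, 5)], [4, 5]),
  (257, 1536, [(2, 3), (1, 6)], [4, 5]),
  (514, 1281, [(1, 4), (2, 6)], [4, 5]),
  (2112, 49, [(3, 5), (4, 6)], [4, 6]),
  (1040, 2822, [(1, 5), (3, 6)], [3, 5]),
  (3, 5456, [(2, 3), (1, 4)], [2, 4]),
  (17, 3338, [(2, 3), (1, 5)], [2, 5]),
  (257, 218, [(2, 3), (1, 6)], [2, 6]),
  (1026, 4912, [(1, 4), (3, 6)], [3, 4]),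
  (264, 182, [(3, 4), (1, 6)], [3, 6]),
  (4098, 816, [(1, 4), (5, 6)], [3, 4]),
  (2064, 774, [(1, 5), (4, 6)], [3, 5]),
  (384, 54, [(4, 5), (1, 6)], [3, 6]),
  (514, 13, [(1, 4), (2, 6)], [5, 6]),
  (20, 97, [(2, 4), (1, 5)], [4, 6]),
  (20, 11, [(2, 4), (1, 5)], [5, 6]),
  (260, 11, [(2, 4), (1, 6)], [5, 6]),
  (66, 5392, [(1, 4), (3, 5)], [2, 4]),
  (324, 6272, [(2, 4), (3, 5), (1, 6)], [1, 2, 3]),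
  (17, 1792, [(2, 3), (1, 5)], [4, 5]),
  (257, 14, [(2, 3), (1, 6)], [5, 6]),
  (1058, 4, [(1, 4), (2, 5), (3, 6)], [3, 5, 6]),
  (3, 3336, [(2, 3), (1, 4)], [2, 5]),
  (3, 112, [(2, 3), (1, 4)], [4, 6]),
  (17, 166, [(2, 3), (1, 5)], [3, 6]),
  (17, 14, [(2, 3), (1, 5)], [5, 6]),
  (257, 112, [(2, 3), (1, 6)], [4, 6]),
  (257, 4656, [(2, 3), (1, 6)], [3, 4]),
  (34, 1793, [(1, 4), (2, 5)], [4, 5]),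
  (257, 7368, [(2, 3), (1, 6)], [1, 2]),
  (3, 6820, [(2, 3), (1, 4)], [1, 3]),
  (514, 6308, [(1, 4), (2, 6)], [1, 3]),
  (2, 6001, [(1, 4)], [4]),
  (16, 3855, [(1, 5)], [5]),
  (256, 255, [(1, 6)], [6]),
  (3, 216, [(2, 3), (1, 4)], [2, 6]),
  (3, 2820, [(2, 3), (1, 4)], [3, 5]),
  (17, 202, [(2, 3), (1, 5)], [2, 6])]
def cut6 : List (ℕ × List (Fin 7)) := [
  (274, [1]),
  (1097, [1, 2, 4, 5, 6]),
  (549, [1, 3, 4, 5, 6]),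
  (2190, [1, 2, 3, 5, 6])]

theorem all5 : cmAll (cmChk tab5 cut5) 8 0 = true := by decide +kernel
theorem all6 : cmAll (cmChk tab6 cut6) 13 0 = true := by decide +kernel
theorem tab5_ok : ∀ c ∈ tab5, cmStat (cmS c.2.2.1) (cmX c.2.2.1 c.2.2.2) ∧
      (∀ a b, a ≠ 0 → b ≠ 0 → s(a, b) ∈ cmX c.2.2.1 c.2.2.2 →
        ∃ k, (pr5 k = (a, b) ∨ pr5 k = (b, a)) ∧ c.1.testBit k = true) ∧
      (∀ k : Fin 8, c.2.1.testBit k = true ∨ s((pr5 k).1, (pr5 k).2) ∈ cmX c.2.2.1 c.2.2.2 ∨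
        s(0, (pr5 k).1) ∈ cmX c.2.2.1 c.2.2.2 ∨ s(0, (pr5 k).2) ∈ cmX c.2.2.1 c.2.2.2) := by
  decide +kernel
theorem tab6_ok : ∀ c ∈ tab6, cmStat (cmS c.2.2.1) (cmX c.2.2.1 c.2.2.2) ∧
      (∀ a b, a ≠ 0 → b ≠ 0 → s(a, b) ∈ cmX c.2.2.1 c.2.2.2 →
        ∃ k, (pr6 k = (a, b) ∨ pr6 k = (b, a)) ∧ c.1.testBit k = true) ∧
      (∀ k : Fin 13, c.2.1.testBit k = true ∨ s((pr6 k).1, (pr6 k).2) ∈ cmX c.2.2.1 c.2.2.2 ∨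
        s(0, (pr6 k).1) ∈ cmX c.2.2.1 c.2.2.2 ∨ s(0, (pr6 k).2) ∈ cmX c.2.2.1 c.2.2.2) := by
  decide +kernel
theorem cut5_ok : ∀ c ∈ cut5, 0 ∉ c.2 ∧ (∃ i, i ∈ c.2) ∧ (∃ i, i ≠ 0 ∧ i ∉ c.2) ∧
      ∀ k, (¬ ((pr5 k).1 ∈ c.2 ↔ (pr5 k).2 ∈ c.2)) → c.1.testBit k = true := by
  decide +kernel
theorem cut6_ok : ∀ c ∈ cut6, 0 ∉ c.2 ∧ (∃ i, i ∈ c.2) ∧ (∃ i, i ≠ 0 ∧ i ∉ c.2) ∧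
      ∀ k, (¬ ((pr6 k).1 ∈ c.2 ↔ (pr6 k).2 ∈ c.2)) → c.1.testBit k = true := by
  decide +kernel
theorem pr5_ok : ∀ a b : Fin 6, a ≠ 0 → b ≠ 0 → a ≠ b → (a = 1 ∧ b = 2) ∨ (a = 2 ∧ b = 1) ∨
    (a = 1 ∧ b = 3) ∨ (a = 3 ∧ b = 1) ∨ ∃ k, pr5 k = (a, b) ∨ pr5 k = (b, a) := by
  decide +kernel
theorem pr6_ok : ∀ a b : Fin 7, a ≠ 0 → b ≠ 0 → a ≠ b → (a = 1 ∧ b = 2) ∨ (a = 2 ∧ b = 1) ∨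
    (a = 1 ∧ b = 3) ∨ (a = 3 ∧ b = 1) ∨ ∃ k, pr6 k = (a, b) ∨ pr6 k = (b, a) := by
  decide +kernel

theorem cm_closed [Fintype V] (G : SimpleGraph V) (hrob : Robust G) (v : V) (D : Set V)
    (hcl : ∀ a b, a ∈ D → G.Adj v b → G.Adj a b → b ∈ D) (d : V) (hd : d ∈ D) (hvd : G.Adj v d) :
    5 ≤ (D ∩ G.neighborSet v).ncard := by
  let d' : G.neighborSet v := ⟨d, hvd⟩
  have h5 := hrob v ((G.induce (G.neighborSet v)).connectedComponentMk d')
  have hreach : ∀ x y : G.neighborSet v, (G.induce (G.neighborSet v)).Reachable x y →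
      x.1 ∈ D → y.1 ∈ D := by
    rintro x y ⟨p⟩
    induction p with
    | nil => exact id
    | @cons a b c hab q ih =>
      intro ha
      exact ih (hcl _ _ ha b.2 hab)
  refine h5.trans ?_
  rw [← Set.ncard_image_of_injective _ Subtype.val_injective]
  refine Set.ncard_le_ncard ?_ (Set.toFinite _)
  rintro _ ⟨y, hy, rfl⟩
  refine ⟨?_, y.2⟩
  have : (G.induce (G.neighborSet v)).Reachable y d' := SimpleGraph.ConnectedComponent.exact hy
  exact hreach d' y this.symm hd

theorem cm_conn [Fintype V] (G : SimpleGraph V) (hrob : Robust G) (v : V)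
    (hd : (G.neighborSet v).ncard ≤ 6) (D : Set V) (c d : V) (hc : c ∈ D) (hvc : G.Adj v c)
    (hdD : d ∉ D) (hvd : G.Adj v d) :
    ∃ a b, a ∈ D ∧ b ∉ D ∧ G.Adj v a ∧ G.Adj v b ∧ G.Adj a b := by
  by_contra hcon
  push Not at hcon
  have h1 := cm_closed G hrob v (D ∩ G.neighborSet v) (by
    intro a b ha hb hab
    by_contra hbD
    exact hcon a b ha.1 (fun h => hbD ⟨h, hb⟩) ha.2 hb hab) c ⟨hc, hvc⟩ hvc
  have h2 := cm_closed G hrob v (Dᶜ ∩ G.neighborSet v) (by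
    intro a b ha hb hab
    by_contra hbD
    have hbD' : b ∈ D := by
      by_contra h
      exact hbD ⟨h, hb⟩
    exact hcon b a hbD' ha.1 hb ha.2 hab.symm) d ⟨hdD, hvd⟩ hvd
  rw [Set.inter_assoc, Set.inter_self] at h1 h2
  have h3 := Set.ncard_union_eq (s := D ∩ G.neighborSet v) (t := Dᶜ ∩ G.neighborSet v)
    (by
      rw [Set.disjoint_left]
      rintro x hx hx'
      exact hx'.1 hx.1) (Set.toFinite _) (Set.toFinite _)
  have h4 := Set.ncard_le_ncard (s := (D ∩ G.neighborSet v) ∪ (Dᶜ ∩ G.neighborSet v))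
    (t := G.neighborSet v) (by rintro x (hx | hx) <;> exact hx.2) (Set.toFinite _)
  omega

theorem cm_enum [Fintype V] [DecidableEq V] (G : SimpleGraph V) (v : V) (l : List V)
    (hl : l.Nodup) (hlv : ∀ w ∈ l, G.Adj v w) :
    ∃ l', (v :: (l ++ l')).Nodup ∧ (∀ w, w ∈ l ++ l' ↔ G.Adj v w) ∧
      l.length + l'.length = (G.neighborSet v).ncard := by
  classical
  have hmem : ∀ w, w ∈ l ++ ((G.neighborFinset v) \ l.toFinset).toList ↔ G.Adj v w := by
    intro w
    simp only [List.mem_append, Finset.mem_toList, Finset.mem_sdiff, mem_neighborFinset,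
      List.mem_toFinset]
    have := hlv w
    tauto
  have hnd : (l ++ ((G.neighborFinset v) \ l.toFinset).toList).Nodup := by
    rw [List.nodup_append']
    refine ⟨hl, Finset.nodup_toList _, ?_⟩
    intro a ha hb
    simp only [Finset.mem_toList, Finset.mem_sdiff, List.mem_toFinset] at hb
    exact hb.2 ha
  refine ⟨((G.neighborFinset v) \ l.toFinset).toList, ?_, hmem, ?_⟩
  · rw [List.nodup_cons]
    refine ⟨?_, hnd⟩
    rw [hmem]
    exact G.irrefl
  · rw [← List.length_append, ← List.toFinset_card_of_nodup hnd, ← Set.ncard_coe_finset]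
    congr 1
    ext w
    have := hmem w
    simpa only [Finset.mem_coe, List.mem_toFinset, mem_neighborSet] using this

theorem cm_get (G : SimpleGraph V) (v : V) (L : List V) (hnd : (v :: L).Nodup)
    (hmem : ∀ w, w ∈ L ↔ G.Adj v w) (w : V) :
    G.Adj v w ↔ ∃ i : Fin (L.length + 1), i ≠ 0 ∧ (v :: L).get i = w := by
  rw [← hmem]
  constructor
  · intro h
    obtain ⟨i, hi⟩ := List.mem_iff_get.1 h
    exact ⟨i.succ, Fin.succ_ne_zero _, hi⟩
  · rintro ⟨i, hi, rfl⟩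
    obtain ⟨j, rfl⟩ := Fin.exists_succ_eq.2 hi
    exact List.get_mem L j

theorem cm_hconn [Fintype V] (G : SimpleGraph V) (hrob : Robust G) {m : ℕ} (f : Fin (m + 1) → V)
    (hd : (G.neighborSet (f 0)).ncard ≤ 6)
    (hf : Function.Injective f)
    (hr : ∀ w, G.Adj (f 0) w ↔ ∃ i, i ≠ 0 ∧ f i = w)
    (C : List (Fin (m + 1))) (h0 : 0 ∉ C) (h1 : ∃ i, i ∈ C) (h2 : ∃ i, i ≠ 0 ∧ i ∉ C) :
      ∃ a b, a ∈ C ∧ b ∉ C ∧ b ≠ 0 ∧ G.Adj (f a) (f b) := by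
  obtain ⟨i, hi⟩ := h1
  obtain ⟨j, hj0, hj⟩ := h2
  have hi0 : i ≠ 0 := by rintro rfl; exact h0 hi
  obtain ⟨a, b, ha, hb, hva, hvb, hab⟩ := cm_conn G hrob (f 0) hd (f '' {i | i ∈ C}) (f i) (f j)
    ⟨i, hi, rfl⟩ ((hr _).2 ⟨i, hi0, rfl⟩)
    (by rintro ⟨k, hk, hkj⟩; rw [hf hkj] at hk; exact hj hk) ((hr _).2 ⟨j, hj0, rfl⟩)
  obtain ⟨a, ha', rfl⟩ := ha
  obtain ⟨b, hb0, rfl⟩ := (hr _).1 hvb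
  exact ⟨a, b, ha', fun h => hb ⟨b, h, rfl⟩, hb0, hab⟩

theorem cm_five [Fintype V] (G : SimpleGraph V) (hrob : Robust G) (v x : V) (hx : G.Adj v x) :
    5 ≤ (G.neighborSet v).ncard := by
  have := cm_closed G hrob v Set.univ (fun _ _ _ _ _ => trivial) x trivial hx
  rwa [Set.univ_inter] at this

theorem cm_part1 [Fintype V] [DecidableEq V] (G : SimpleGraph V)
    (hrob : Robust G) (v : V) (hd : (G.neighborSet v).ncard ≤ 6) (x y z : V)
    (hx : G.Adj v x) (hy : G.Adj v y) (hz : G.Adj v z) (hxy : x ≠ y) (hxz : x ≠ z) (hyz : y ≠ z)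
    (nxy : ¬ G.Adj x y) (nxz : ¬ G.Adj x z) : ReducibleVertexSet G {v} := by
  obtain ⟨l, hnd, hmem, hlen⟩ := cm_enum G v [x, y, z] (by simp [hxy, hxz, hyz])
    (by simp [hx, hy, hz])
  have h5 := cm_five G hrob v x hx
  have nyx : ¬ G.Adj y x := fun h => nxy h.symm
  have nzx : ¬ G.Adj z x := fun h => nxz h.symm
  simp only [List.length_cons, List.length_nil] at hlen
  have hl : l.length = 2 ∨ l.length = 3 := by omega
  rcases hl with hl | hl
  · obtain ⟨a, b, rfl⟩ := List.length_eq_two.1 hl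
    have hinj := List.nodup_iff_injective_get.1 hnd
    have hr := cm_get G v _ hnd hmem
    let f : Fin (5 + 1) → V := [v, x, y, z, a, b].get
    refine cm_main G (m := 5) f hinj hr pr5 ?_ tab5 cut5 tab5_ok cut5_ok all5
      (cm_hconn G hrob f hd hinj hr)
    intro i j hi hj hij
    rcases pr5_ok i j hi hj (by rintro rfl; exact G.irrefl hij) with
      ⟨rfl, rfl⟩ | ⟨rfl, rfl⟩ | ⟨rfl, rfl⟩ | ⟨rfl, rfl⟩ | h
    · exact absurd hij nxy
    · exact absurd hij nyx
    · exact absurd hij nxz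
    · exact absurd hij nzx
    · exact h
  · obtain ⟨a, b, c, rfl⟩ := List.length_eq_three.1 hl
    have hinj := List.nodup_iff_injective_get.1 hnd
    have hr := cm_get G v _ hnd hmem
    let f : Fin (6 + 1) → V := [v, x, y, z, a, b, c].get
    refine cm_main G (m := 6) f hinj hr pr6 ?_ tab6 cut6 tab6_ok cut6_ok all6
      (cm_hconn G hrob f hd hinj hr)
    intro i j hi hj hij
    rcases pr6_ok i j hi hj (by rintro rfl; exact G.irrefl hij) with
      ⟨rfl, rfl⟩ | ⟨rfl, rfl⟩ | ⟨rfl, rfl⟩ | ⟨rfl, rfl⟩ | h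
    · exact absurd hij nxy
    · exact absurd hij nyx
    · exact absurd hij nxz
    · exact absurd hij nzx
    · exact h

def S5 : Finset (Finset (Fin (5 + 1))) := {{1, 3, 5}, {2, 4, 5}, {0, 2, 3}, {0, 1, 4}}
def X5 : Finset (Sym2 (Fin (5 + 1))) :=
  {s(1, 3), s(1, 5), s(3, 5), s(2, 4), s(2, 5), s(4, 5), s(2, 3), s(1, 4)}
def S6 : Finset (Finset (Fin (6 + 1))) := {{1, 3, 5}, {2, 4, 5}, {0, 2, 3}, {0, 1, 4}, {0, 5, 6}}
def X6 : Finset (Sym2 (Fin (6 + 1))) :=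
  {s(1, 3), s(1, 5), s(3, 5), s(2, 4), s(2, 5), s(4, 5), s(2, 3), s(1, 4), s(5, 6), s(0, 6)}

theorem S5_ok : cmStat S5 X5 ∧ s(1, 2) ∉ X5 ∧ s(3, 4) ∉ X5 ∧
    ∀ a b, a ≠ 0 → b ≠ 0 → a ≠ b → s(a, b) = s(1, 2) ∨ s(a, b) = s(3, 4) ∨
      s(a, b) ∈ X5 ∨ s(0, a) ∈ X5 ∨ s(0, b) ∈ X5 := by
  decide +kernel

theorem S6_ok : cmStat S6 X6 ∧ s(1, 2) ∉ X6 ∧ s(3, 4) ∉ X6 ∧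
    ∀ a b, a ≠ 0 → b ≠ 0 → a ≠ b → s(a, b) = s(1, 2) ∨ s(a, b) = s(3, 4) ∨
      s(a, b) ∈ X6 ∨ s(0, a) ∈ X6 ∨ s(0, b) ∈ X6 := by
  decide +kernel

theorem cm_two [DecidableEq V] (G : SimpleGraph V) {m : ℕ} (f : Fin (m + 1) → V)
    (hf : Function.Injective f)
    (hr : ∀ w, G.Adj (f 0) w ↔ ∃ i, i ≠ 0 ∧ f i = w)
    (S : Finset (Finset (Fin (m + 1)))) (X : Finset (Sym2 (Fin (m + 1))))
    (p q r t : Fin (m + 1))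
    (hS : cmStat S X ∧ s(p, q) ∉ X ∧ s(r, t) ∉ X ∧
      ∀ a b, a ≠ 0 → b ≠ 0 → a ≠ b → s(a, b) = s(p, q) ∨ s(a, b) = s(r, t) ∨
      s(a, b) ∈ X ∨ s(0, a) ∈ X ∨ s(0, b) ∈ X)
    (npq : ¬ G.Adj (f p) (f q)) (nrt : ¬ G.Adj (f r) (f t))
    (hall : ∀ a b, G.Adj (f 0) a → G.Adj (f 0) b → a ≠ b → ¬ G.Adj a b →
      s(a, b) = s(f p, f q) ∨ s(a, b) = s(f r, f t)) : ReducibleVertexSet G {f 0} := by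
  obtain ⟨⟨s1, s2, s3, s4, s5⟩, h1, h2, h3⟩ := hS
  refine cm_crit G f hf hr S X s1 s2 s3 s4
    (fun t ht u hu w hw => by have := s5 t ht u hu w hw; tauto) ?_ ?_
  · intro a b ha hb hab
    by_contra hn
    have hne : a ≠ b := by rintro rfl; exact s4 _ hab
    have hinj : ∀ c d : Fin (m + 1), s(f a, f b) = s(f c, f d) → s(a, b) = s(c, d) := by
      intro c d h
      exact Sym2.map.injective hf h
    rcases hall _ _ ((hr _).2 ⟨a, ha, rfl⟩) ((hr _).2 ⟨b, hb, rfl⟩) (fun h => hne (hf h)) hn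
      with h | h
    · rw [hinj _ _ h] at hab; exact h1 hab
    · rw [hinj _ _ h] at hab; exact h2 hab
  · intro a b ha hb hab
    have key : ∀ c d : Fin (m + 1), ¬ G.Adj (f c) (f d) → s(a, b) ≠ s(c, d) := by
      intro c d hn h
      rcases Sym2.eq_iff.1 h with ⟨rfl, rfl⟩ | ⟨rfl, rfl⟩
      · exact hn hab
      · exact hn hab.symm
    rcases h3 a b ha hb (by rintro rfl; exact G.irrefl hab) with h | h | h
    · exact absurd h (key _ _ npq)
    · exact absurd h (key _ _ nrt)
    · exact h

theorem cm_part2 [Fintype V] [DecidableEq V] (G : SimpleGraph V)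
    (hrob : Robust G) (v : V) (hd : (G.neighborSet v).ncard ≤ 6) (x y z w : V)
    (hx : G.Adj v x) (hy : G.Adj v y) (hz : G.Adj v z) (hw : G.Adj v w)
    (hnd0 : [x, y, z, w].Nodup)
    (nxy : ¬ G.Adj x y) (nzw : ¬ G.Adj z w)
    (hall : ∀ a b, G.Adj v a → G.Adj v b → a ≠ b → ¬ G.Adj a b →
      s(a, b) = s(x, y) ∨ s(a, b) = s(z, w)) : ReducibleVertexSet G {v} := by
  obtain ⟨l, hnd, hmem, hlen⟩ := cm_enum G v [x, y, z, w] hnd0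
    (by simp [hx, hy, hz, hw])
  have h5 := cm_five G hrob v x hx
  simp only [List.length_cons, List.length_nil] at hlen
  have hl : l.length = 1 ∨ l.length = 2 := by omega
  rcases hl with hl | hl
  · obtain ⟨a, rfl⟩ := List.length_eq_one_iff.1 hl
    have hinj := List.nodup_iff_injective_get.1 hnd
    have hr := cm_get G v _ hnd hmem
    let f : Fin (5 + 1) → V := [v, x, y, z, w, a].get
    exact cm_two G (m := 5) f hinj hr S5 X5 1 2 3 4 S5_ok nxy nzw hall
  · obtain ⟨a, b, rfl⟩ := List.length_eq_two.1 hl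
    have hinj := List.nodup_iff_injective_get.1 hnd
    have hr := cm_get G v _ hnd hmem
    let f : Fin (6 + 1) → V := [v, x, y, z, w, a, b].get
    exact cm_two G (m := 6) f hinj hr S6 X6 1 2 3 4 S6_ok nxy nzw hall

/-- Let `G` be robust and `v` a vertex of degree at most 6. If the complement of
`G[N(v)]` has maximum degree greater than 1, then `{v}` is reducible; also, if the
complement of `G[N(v)]` has exactly 2 edges, then `{v}` is reducible. -/
theorem comp_matching_reducible [Fintype V] [DecidableEq V] (G : SimpleGraph V)
    (hrob : Robust G) (v : V) (hd : (G.neighborSet v).ncard ≤ 6) :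
    ((∃ x, 2 ≤ ((G.induce (G.neighborSet v))ᶜ.neighborSet x).ncard) →
        ReducibleVertexSet G {v}) ∧
      ((G.induce (G.neighborSet v))ᶜ.edgeSet.ncard = 2 → ReducibleVertexSet G {v}) := by

  constructor
  · rintro ⟨x, hx⟩
    obtain ⟨y, z, hy, hz, hyz⟩ := (Set.one_lt_ncard_iff (Set.toFinite _)).1 hx
    have hy' := (SimpleGraph.compl_adj _ _ _).1 ((SimpleGraph.mem_neighborSet _ _ _).1 hy)
    have hz' := (SimpleGraph.compl_adj _ _ _).1 ((SimpleGraph.mem_neighborSet _ _ _).1 hz)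
    exact cm_part1 G hrob v hd x y z x.2 y.2 z.2 (fun h => hy'.1 (Subtype.ext h))
      (fun h => hz'.1 (Subtype.ext h)) (fun h => hyz (Subtype.ext h)) hy'.2 hz'.2
  · intro h
    obtain ⟨e₁, e₂, hne, he⟩ := Set.ncard_eq_two.1 h
    induction e₁ with | _ x y => ?_
    induction e₂ with | _ z w => ?_
    have mem : ∀ a b : G.neighborSet v, (a ≠ b ∧ ¬ G.Adj a b) ↔
        s(a, b) = s(x, y) ∨ s(a, b) = s(z, w) := by
      intro a b
      have h1 : s(a, b) ∈ (G.induce (G.neighborSet v))ᶜ.edgeSet ↔ a ≠ b ∧ ¬ G.Adj a b := by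
        rw [SimpleGraph.mem_edgeSet, SimpleGraph.compl_adj]; rfl
      rw [← h1, he]; rfl
    obtain ⟨hxy, nxy⟩ := (mem x y).2 (Or.inl rfl)
    obtain ⟨hzw, nzw⟩ := (mem z w).2 (Or.inr rfl)
    have P : ∀ a b c : G.neighborSet v, a ≠ b → a ≠ c → b ≠ c → ¬ G.Adj a b → ¬ G.Adj a c →
        ReducibleVertexSet G {v} := fun a b c hab hac hbc nab nac =>
      cm_part1 G hrob v hd a b c a.2 b.2 c.2 (fun h => hab (Subtype.ext h))
        (fun h => hac (Subtype.ext h)) (fun h => hbc (Subtype.ext h)) nab nac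
    have nyx : ¬ G.Adj y x := fun h => nxy h.symm
    have nwz : ¬ G.Adj w z := fun h => nzw h.symm
    by_cases hxz : x = z
    · subst hxz
      exact P x y w hxy hzw (by rintro rfl; exact hne rfl) nxy nzw
    by_cases hxw : x = w
    · subst hxw
      exact P x y z hxy hzw.symm (by rintro rfl; exact hne Sym2.eq_swap) nxy nwz
    by_cases hyz : y = z
    · subst hyz
      exact P y x w hxy.symm hzw hxw nyx nzw
    by_cases hyw : y = w
    · subst hyw
      exact P y x z hxy.symm hzw.symm hxz nyx nwz
    refine cm_part2 G hrob v hd x y z w x.2 y.2 z.2 w.2 ?_ nxy nzw ?_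
    · simp only [List.nodup_cons, List.mem_cons, List.not_mem_nil, or_false, not_or,
        not_false_eq_true, List.nodup_nil, and_true, ← Subtype.ext_iff]
      exact ⟨⟨hxy, hxz, hxw⟩, ⟨hyz, hyw⟩, hzw⟩
    · intro a b ha hb hab nab
      have := (mem ⟨a, ha⟩ ⟨b, hb⟩).1 ⟨fun h => hab (congrArg Subtype.val h), nab⟩
      rcases this with h | h
      · exact Or.inl (congrArg (Sym2.map Subtype.val) h)
      · exact Or.inr (congrArg (Sym2.map Subtype.val) h)
end

section
/- Let G be a finite simple robust graph. If uv is an edge of G with d(u) ≤ 6 and d(v) ≤ 6, then at least one of the vertex sets {u}, {v}, or {u, v} is a reducible vertex set in G. -/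
open SimpleGraph

variable {V : Type*}

set_option maxRecDepth 100000
def triF {n : ℕ} (t : Fin n × Fin n × Fin n) : Finset (Fin n) := {t.1, t.2.1, t.2.2}

def inL {n : ℕ} (L : List (Fin n × Fin n)) (i j : Fin n) : Prop := (i, j) ∈ L ∨ (j, i) ∈ L

instance {n : ℕ} (L : List (Fin n × Fin n)) (i j : Fin n) : Decidable (inL L i j) := by
  unfold inL; infer_instance

def CertOK {n : ℕ} (V0 : List (Fin n)) (S0 : List (Fin n × Fin n × Fin n))
    (X0 N0 : List (Fin n × Fin n)) : Prop :=
  V0 ≠ [] ∧ S0.Pairwise (fun t t' => (triF t ∩ triF t').card ≤ 1) ∧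
  X0.length ≤ 2 * S0.length ∧
  (∀ i ∈ V0, ∀ j k, i ≠ j → i ≠ k → j ≠ k →
    inL X0 i j ∨ inL X0 i k ∨ inL X0 j k ∨ inL N0 i j ∨ inL N0 i k ∨ inL N0 j k) ∧
  (∀ t ∈ S0, ∀ a ∈ triF t, ∀ b ∈ triF t, a ≠ b → a ∉ V0 → b ∉ V0 → inL X0 a b)

set_option synthInstance.maxSize 2000 in
set_option synthInstance.maxHeartbeats 200000 in
instance {n : ℕ} (V0 : List (Fin n)) (S0 : List (Fin n × Fin n × Fin n))
    (X0 N0 : List (Fin n × Fin n)) : Decidable (CertOK V0 S0 X0 N0) := by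
  unfold CertOK; infer_instance

theorem cert [DecidableEq V] (G : SimpleGraph V) {n : ℕ} (f : Fin n → V)
    (V0 : List (Fin n)) (S0 : List (Fin n × Fin n × Fin n))
    (X0 N0 : List (Fin n × Fin n)) (hok : CertOK V0 S0 X0 N0)
    (hf : Function.Injective f)
    (hS : ∀ t ∈ S0, G.Adj (f t.1) (f t.2.1) ∧ G.Adj (f t.1) (f t.2.2) ∧ G.Adj (f t.2.1) (f t.2.2))
    (hN : ∀ e ∈ N0, ¬ G.Adj (f e.1) (f e.2))
    (hV : ∀ i ∈ V0, ∀ w, G.Adj (f i) w → ∃ j, f j = w) :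
    ReducibleVertexSet G (V0.map f).toFinset := by
  classical
  obtain ⟨hne, hdisj, hcard, hcov, hout⟩ := hok
  have h3 : ∀ t ∈ S0, (triF t).card = 3 := by
    intro t ht
    obtain ⟨h1, h2, h3⟩ := hS t ht
    rw [triF, Finset.card_eq_three]
    refine ⟨_, _, _, ?_, ?_, ?_, rfl⟩
    · intro h; rw [h] at h1; exact G.loopless.irrefl _ h1
    · intro h; rw [h] at h2; exact G.loopless.irrefl _ h2
    · intro h; rw [h] at h3; exact G.loopless.irrefl _ h3
  have hadj : ∀ t ∈ S0, ∀ a ∈ triF t, ∀ b ∈ triF t, a ≠ b → G.Adj (f a) (f b) := by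
    intro t ht a ha b hb hab
    obtain ⟨h1, h2, h3⟩ := hS t ht
    simp only [triF, Finset.mem_insert, Finset.mem_singleton] at ha hb
    have := h1.symm
    have := h2.symm
    have := h3.symm
    rcases ha with rfl | rfl | rfl <;> rcases hb with rfl | rfl | rfl <;> first | assumption | exact absurd rfl hab
  have hpw : ∀ t ∈ S0, ∀ t' ∈ S0, (triF t).image f ≠ (triF t').image f →
      (triF t ∩ triF t').card ≤ 1 := by
    intro t ht t' ht' hne
    have : Std.Symm (fun t t' : Fin n × Fin n × Fin n => (triF t ∩ triF t').card ≤ 1) :=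
      ⟨fun x y h => by rw [Finset.inter_comm]; exact h⟩
    exact hdisj.forall ht ht' (fun h => hne (by rw [h]))
  have hnd : (S0.map (fun t => (triF t).image f)).Nodup := by
    rw [List.Nodup, List.pairwise_map]
    refine (List.Pairwise.and_mem.1 hdisj).imp ?_
    rintro t t' ⟨ht, ht', h⟩ he
    have := Finset.image_injective hf he
    rw [this, Finset.inter_self, h3 t' ht'] at h
    omega
  have hX : ∀ i j, inL X0 i j → s(f i, f j) ∈ X0.map (fun e => s(f e.1, f e.2)) := by
    intro i j h
    rcases h with h | h
    · exact List.mem_map.2 ⟨_, h, rfl⟩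
    · exact List.mem_map.2 ⟨_, h, Sym2.eq_swap⟩
  have hNn : ∀ i j, inL N0 i j → ¬ G.Adj (f i) (f j) := by
    intro i j h
    rcases h with h | h
    · exact hN _ h
    · intro h'; exact hN _ h h'.symm
  refine ⟨?_, (S0.map (fun t => (triF t).image f)).toFinset,
    (X0.map (fun e => s(f e.1, f e.2))).toFinset.filter (fun e => e ∈ G.edgeSet), ⟨?_, ?_⟩, ?_, ?_, ?_, ?_⟩
  · obtain ⟨a, l, rfl⟩ := List.exists_cons_of_ne_nil hne
    exact ⟨f a, by simp⟩
  · intro t ht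
    simp only [List.mem_toFinset, List.mem_map] at ht
    obtain ⟨t, ht, rfl⟩ := ht
    constructor
    · intro x hx y hy hxy
      simp only [Finset.coe_image, Set.mem_image, Finset.mem_coe] at hx hy
      obtain ⟨a, ha, rfl⟩ := hx
      obtain ⟨b, hb, rfl⟩ := hy
      exact hadj t ht a ha b hb (fun h => hxy (by rw [h]))
    · rw [Finset.card_image_of_injective _ hf, h3 t ht]
  · intro t1 ht1 t2 ht2 hne
    simp only [List.mem_toFinset, List.mem_map] at ht1 ht2
    obtain ⟨t, ht, rfl⟩ := ht1
    obtain ⟨t', ht', rfl⟩ := ht2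
    rw [← Finset.image_inter _ _ hf, Finset.card_image_of_injective _ hf]
    exact hpw t ht t' ht' hne
  · intro e he
    exact (Finset.mem_filter.1 he).2
  · rw [List.toFinset_card_of_nodup hnd, List.length_map]
    refine le_trans (Finset.card_filter_le _ _) (le_trans (List.toFinset_card_le _) ?_)
    simpa using hcard
  · intro t ht x hx hxt
    simp only [List.mem_toFinset, List.mem_map] at hx
    obtain ⟨i, hi, rfl⟩ := hx
    have h2 : (t.erase (f i)).card = 2 := by rw [Finset.card_erase_of_mem hxt, ht.2]
    obtain ⟨y, z, hyz, hyze⟩ := Finset.card_eq_two.1 h2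
    have hy : y ∈ t.erase (f i) := by rw [hyze]; simp
    have hz : z ∈ t.erase (f i) := by rw [hyze]; simp
    rw [Finset.mem_erase] at hy hz
    have a1 := ht.1 hxt hy.2 hy.1.symm
    have a2 := ht.1 hxt hz.2 hz.1.symm
    have a3 := ht.1 hy.2 hz.2 hyz
    rw [SimpleGraph.deleteEdges_adj] at a1 a2 a3
    obtain ⟨j, rfl⟩ := hV i hi y a1.1
    obtain ⟨k, rfl⟩ := hV i hi z a2.1
    have key : ∀ i j, G.Adj (f i) (f j) ∧ s(f i, f j) ∉ (↑((X0.map (fun e => s(f e.1, f e.2))).toFinset.filter (fun e => e ∈ G.edgeSet)) : Set (Sym2 V)) → ¬ inL X0 i j := by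
      rintro i j ⟨h1, h2⟩ h
      apply h2
      rw [Finset.mem_coe, Finset.mem_filter, List.mem_toFinset]
      exact ⟨hX _ _ h, h1⟩
    rcases hcov i hi j k (fun h => hy.1 (by rw [h])) (fun h => hz.1 (by rw [h]))
      (fun h => hyz (by rw [h])) with h | h | h | h | h | h
    · exact key _ _ a1 h
    · exact key _ _ a2 h
    · exact key _ _ a3 h
    · exact hNn _ _ h a1.1
    · exact hNn _ _ h a2.1
    · exact hNn _ _ h a3.1
  · intro t ht x hx y hy hxy hx0 hy0
    simp only [List.mem_toFinset, List.mem_map] at ht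
    obtain ⟨t, ht, rfl⟩ := ht
    obtain ⟨a, ha, rfl⟩ := Finset.mem_image.1 hx
    obtain ⟨b, hb, rfl⟩ := Finset.mem_image.1 hy
    have hab : a ≠ b := fun h => hxy (by rw [h])
    rw [Finset.mem_filter, List.mem_toFinset]
    refine ⟨hX _ _ (hout t ht a ha b hb hab ?_ ?_), hadj t ht a ha b hb hab⟩
    · intro h; exact hx0 (by simpa using ⟨a, h, rfl⟩)
    · intro h; exact hy0 (by simpa using ⟨b, h, rfl⟩)

theorem robust_out (G : SimpleGraph V) (hrob : Robust G) (v : V) (A : Finset V)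
    (hA : A.Nonempty) (hAN : ∀ a ∈ A, G.Adj v a) (hc : A.card ≤ 4) :
    ∃ a ∈ A, ∃ b, b ∉ A ∧ G.Adj v b ∧ G.Adj a b := by
  by_contra hcon
  push Not at hcon
  obtain ⟨a, ha⟩ := hA
  set H := G.induce (G.neighborSet v)
  let a' : G.neighborSet v := ⟨a, hAN a ha⟩
  have h5 := hrob v (H.connectedComponentMk a')
  have hsub : ∀ b : G.neighborSet v, H.Reachable a' b → (b : V) ∈ A := by
    rintro b ⟨w⟩
    have : ∀ (x y : G.neighborSet v) (w : H.Walk x y), (x : V) ∈ A → (y : V) ∈ A := by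
      intro x y w
      induction w with
      | nil => exact id
      | cons h p ih =>
        intro hx
        apply ih
        by_contra hn
        exact hcon _ hx _ hn (Subtype.prop _) h
    exact this _ _ w ha
  have : (Subtype.val '' (H.connectedComponentMk a').supp).ncard ≤ (A : Set V).ncard := by
    apply Set.ncard_le_ncard _ A.finite_toSet
    rintro _ ⟨b, hb, rfl⟩
    refine hsub b ?_
    rw [SimpleGraph.ConnectedComponent.mem_supp_iff, SimpleGraph.ConnectedComponent.eq] at hb
    exact hb.symm
  rw [Set.ncard_image_of_injective _ Subtype.val_injective, Set.ncard_coe_finset] at this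
  omega

def Lab5 (G : SimpleGraph V) (v x y z p q : V) : Prop :=
  [x, y, z, p, q].Nodup ∧ ∀ w, G.Adj v w ↔ w = x ∨ w = y ∨ w = z ∨ w = p ∨ w = q

theorem Lab5.adj_x {G : SimpleGraph V} {v x y z p q : V} (h : Lab5 G v x y z p q) :
    G.Adj v x := by rw [h.2]; simp

theorem Lab5.adj_y {G : SimpleGraph V} {v x y z p q : V} (h : Lab5 G v x y z p q) :
    G.Adj v y := by rw [h.2]; simp

theorem Lab5.adj_z {G : SimpleGraph V} {v x y z p q : V} (h : Lab5 G v x y z p q) :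
    G.Adj v z := by rw [h.2]; simp

theorem Lab5.adj_p {G : SimpleGraph V} {v x y z p q : V} (h : Lab5 G v x y z p q) :
    G.Adj v p := by rw [h.2]; simp

theorem Lab5.adj_q {G : SimpleGraph V} {v x y z p q : V} (h : Lab5 G v x y z p q) :
    G.Adj v q := by rw [h.2]; simp

theorem Lab5.inj {G : SimpleGraph V} {v x y z p q : V} (h : Lab5 G v x y z p q) :
    Function.Injective ![v, x, y, z, p, q] := by
  rw [← List.nodup_ofFn]
  have := h.1
  simp [h.adj_x.ne, h.adj_y.ne, h.adj_z.ne, h.adj_p.ne, h.adj_q.ne] at this ⊢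
  tauto

theorem Lab5.cov {G : SimpleGraph V} {v x y z p q : V} (h : Lab5 G v x y z p q) :
    ∀ w, G.Adj v w → ∃ j, ![v, x, y, z, p, q] j = w := by
  intro w hw
  rcases (h.2 w).1 hw with rfl | rfl | rfl | rfl | rfl
  · exact ⟨1, rfl⟩
  · exact ⟨2, rfl⟩
  · exact ⟨3, rfl⟩
  · exact ⟨4, rfl⟩
  · exact ⟨5, rfl⟩

def Lab6 (G : SimpleGraph V) (v x y z p q r : V) : Prop :=
  [x, y, z, p, q, r].Nodup ∧ ∀ w, G.Adj v w ↔ w = x ∨ w = y ∨ w = z ∨ w = p ∨ w = q ∨ w = r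

theorem Lab6.adj_x {G : SimpleGraph V} {v x y z p q r : V} (h : Lab6 G v x y z p q r) :
    G.Adj v x := by rw [h.2]; simp

theorem Lab6.adj_y {G : SimpleGraph V} {v x y z p q r : V} (h : Lab6 G v x y z p q r) :
    G.Adj v y := by rw [h.2]; simp

theorem Lab6.adj_z {G : SimpleGraph V} {v x y z p q r : V} (h : Lab6 G v x y z p q r) :
    G.Adj v z := by rw [h.2]; simp

theorem Lab6.adj_p {G : SimpleGraph V} {v x y z p q r : V} (h : Lab6 G v x y z p q r) :
    G.Adj v p := by rw [h.2]; simp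

theorem Lab6.adj_q {G : SimpleGraph V} {v x y z p q r : V} (h : Lab6 G v x y z p q r) :
    G.Adj v q := by rw [h.2]; simp

theorem Lab6.adj_r {G : SimpleGraph V} {v x y z p q r : V} (h : Lab6 G v x y z p q r) :
    G.Adj v r := by rw [h.2]; simp

theorem Lab6.inj {G : SimpleGraph V} {v x y z p q r : V} (h : Lab6 G v x y z p q r) :
    Function.Injective ![v, x, y, z, p, q, r] := by
  rw [← List.nodup_ofFn]
  have := h.1
  simp [h.adj_x.ne, h.adj_y.ne, h.adj_z.ne, h.adj_p.ne, h.adj_q.ne, h.adj_r.ne] at this ⊢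
  tauto

theorem Lab6.cov {G : SimpleGraph V} {v x y z p q r : V} (h : Lab6 G v x y z p q r) :
    ∀ w, G.Adj v w → ∃ j, ![v, x, y, z, p, q, r] j = w := by
  intro w hw
  rcases (h.2 w).1 hw with rfl | rfl | rfl | rfl | rfl | rfl
  · exact ⟨1, rfl⟩
  · exact ⟨2, rfl⟩
  · exact ⟨3, rfl⟩
  · exact ⟨4, rfl⟩
  · exact ⟨5, rfl⟩
  · exact ⟨6, rfl⟩

theorem star5 [DecidableEq V] {G : SimpleGraph V} {v x y z p q : V} (h : Lab5 G v x y z p q)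
    (hpx : G.Adj p x) (nxy : ¬ G.Adj x y) (nxz : ¬ G.Adj x z) (nxq : ¬ G.Adj x q) (nyz : ¬ G.Adj y z) (nyq : ¬ G.Adj y q) (nzq : ¬ G.Adj z q) : ReducibleVertexSet G {v} := by
  have := cert G ![v, x, y, z, p, q] [0] [(0, 4, 1)] [(4, 1), (0, 4)]
    [(1, 2), (1, 3), (1, 5), (2, 3), (2, 5), (3, 5)] (by decide) h.inj (by simp [hpx, h.adj_p, h.adj_x])
    (by simp [nxy, nxz, nxq, nyz, nyq, nzq]) (by simpa using h.cov)
  simpa using this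

theorem cov5 [DecidableEq V] {G : SimpleGraph V} {v x y z p q : V} (h : Lab5 G v x y z p q)
    (hxp : G.Adj x p) (hyq : G.Adj y q) (nxy : ¬ G.Adj x y) (nxz : ¬ G.Adj x z) (nyz : ¬ G.Adj y z) : ReducibleVertexSet G {v} := by
  have := cert G ![v, x, y, z, p, q] [0] [(0, 1, 4), (0, 2, 5)] [(1, 4), (2, 5), (0, 4), (0, 5)]
    [(1, 2), (1, 3), (2, 3)] (by decide) h.inj (by simp [hxp, hyq, h.adj_p, h.adj_q, h.adj_x, h.adj_y])
    (by simp [nxy, nxz, nyz]) (by simpa using h.cov)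
  simpa using this

theorem one5a [DecidableEq V] {G : SimpleGraph V} {v x y z p q : V} (h : Lab5 G v x y z p q)
    (hxy : G.Adj x y) (hzp : G.Adj z p) (nxz : ¬ G.Adj x z) (nyz : ¬ G.Adj y z) : ReducibleVertexSet G {v} := by
  have := cert G ![v, x, y, z, p, q] [0] [(0, 1, 2), (0, 3, 4)] [(1, 2), (3, 4), (0, 4), (0, 5)]
    [(1, 3), (2, 3)] (by decide) h.inj (by simp [hxy, hzp, h.adj_p, h.adj_x, h.adj_y, h.adj_z])
    (by simp [nxz, nyz]) (by simpa using h.cov)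
  simpa using this

theorem one5b [DecidableEq V] {G : SimpleGraph V} {v x y z p q : V} (h : Lab5 G v x y z p q)
    (hxy : G.Adj x y) (hpq : G.Adj p q) (nxz : ¬ G.Adj x z) (nyz : ¬ G.Adj y z) : ReducibleVertexSet G {v} := by
  have := cert G ![v, x, y, z, p, q] [0] [(0, 1, 2), (0, 4, 5)] [(1, 2), (4, 5), (0, 4), (0, 5)]
    [(1, 3), (2, 3)] (by decide) h.inj (by simp [hxy, hpq, h.adj_p, h.adj_q, h.adj_x, h.adj_y])
    (by simp [nxz, nyz]) (by simpa using h.cov)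
  simpa using this

theorem star6 [DecidableEq V] {G : SimpleGraph V} {v x y z p q r : V} (h : Lab6 G v x y z p q r)
    (hpx : G.Adj p x) (nxy : ¬ G.Adj x y) (nxz : ¬ G.Adj x z) (nxq : ¬ G.Adj x q) (nxr : ¬ G.Adj x r) (nyz : ¬ G.Adj y z) (nyq : ¬ G.Adj y q) (nyr : ¬ G.Adj y r) (nzq : ¬ G.Adj z q) (nzr : ¬ G.Adj z r) (nqr : ¬ G.Adj q r) : ReducibleVertexSet G {v} := by
  have := cert G ![v, x, y, z, p, q, r] [0] [(0, 4, 1)] [(4, 1), (0, 4)]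
    [(1, 2), (1, 3), (1, 5), (1, 6), (2, 3), (2, 5), (2, 6), (3, 5), (3, 6), (5, 6)] (by decide) h.inj (by simp [hpx, h.adj_p, h.adj_x])
    (by simp [nxy, nxz, nxq, nxr, nyz, nyq, nyr, nzq, nzr, nqr]) (by simpa using h.cov)
  simpa using this

theorem cov6 [DecidableEq V] {G : SimpleGraph V} {v x y z p q r : V} (h : Lab6 G v x y z p q r)
    (hxp : G.Adj x p) (hyq : G.Adj y q) (nxy : ¬ G.Adj x y) (nxz : ¬ G.Adj x z) (nxr : ¬ G.Adj x r) (nyz : ¬ G.Adj y z) (nyr : ¬ G.Adj y r) (nzr : ¬ G.Adj z r) : ReducibleVertexSet G {v} := by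
  have := cert G ![v, x, y, z, p, q, r] [0] [(0, 1, 4), (0, 2, 5)] [(1, 4), (2, 5), (0, 4), (0, 5)]
    [(1, 2), (1, 3), (1, 6), (2, 3), (2, 6), (3, 6)] (by decide) h.inj (by simp [hxp, hyq, h.adj_p, h.adj_q, h.adj_x, h.adj_y])
    (by simp [nxy, nxz, nxr, nyz, nyr, nzr]) (by simpa using h.cov)
  simpa using this

theorem pend6 [DecidableEq V] {G : SimpleGraph V} {v x y z p q r : V} (h : Lab6 G v x y z p q r)
    (hxp : G.Adj x p) (hzq : G.Adj z q) (nxy : ¬ G.Adj x y) (nxz : ¬ G.Adj x z) (nxq : ¬ G.Adj x q) (nxr : ¬ G.Adj x r) (nyz : ¬ G.Adj y z) (nyq : ¬ G.Adj y q) (nyr : ¬ G.Adj y r) : ReducibleVertexSet G {v} := by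
  have := cert G ![v, x, y, z, p, q, r] [0] [(0, 1, 4), (0, 3, 5)] [(1, 4), (3, 5), (0, 4), (0, 6)]
    [(1, 2), (1, 3), (1, 5), (1, 6), (2, 3), (2, 5), (2, 6)] (by decide) h.inj (by simp [hxp, hzq, h.adj_p, h.adj_q, h.adj_x, h.adj_z])
    (by simp [nxy, nxz, nxq, nxr, nyz, nyq, nyr]) (by simpa using h.cov)
  simpa using this

theorem ind6 [DecidableEq V] {G : SimpleGraph V} {v x y z p q r : V} (h : Lab6 G v x y z p q r)
    (hxp : G.Adj x p) (hyq : G.Adj y q) (hzr : G.Adj z r) (nxy : ¬ G.Adj x y) (nxz : ¬ G.Adj x z) (nyz : ¬ G.Adj y z) : ReducibleVertexSet G {v} := by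
  have := cert G ![v, x, y, z, p, q, r] [0] [(0, 1, 4), (0, 2, 5), (0, 3, 6)] [(1, 4), (2, 5), (3, 6), (0, 4), (0, 5), (0, 6)]
    [(1, 2), (1, 3), (2, 3)] (by decide) h.inj (by simp [hxp, hyq, hzr, h.adj_p, h.adj_q, h.adj_r, h.adj_x, h.adj_y, h.adj_z])
    (by simp [nxy, nxz, nyz]) (by simpa using h.cov)
  simpa using this

theorem one6 [DecidableEq V] {G : SimpleGraph V} {v x y z p q r : V} (h : Lab6 G v x y z p q r)
    (hxy : G.Adj x y) (hzp : G.Adj z p) (hqr : G.Adj q r) (nxz : ¬ G.Adj x z) (nyz : ¬ G.Adj y z) : ReducibleVertexSet G {v} := by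
  have := cert G ![v, x, y, z, p, q, r] [0] [(0, 1, 2), (0, 3, 4), (0, 5, 6)] [(1, 2), (3, 4), (5, 6), (0, 4), (0, 5), (0, 6)]
    [(1, 3), (2, 3)] (by decide) h.inj (by simp [hxy, hzp, hqr, h.adj_p, h.adj_q, h.adj_r, h.adj_x, h.adj_y, h.adj_z])
    (by simp [nxz, nyz]) (by simpa using h.cov)
  simpa using this

theorem nbr {G : SimpleGraph V} (hrob : Robust G) {v a : V} (h : G.Adj v a) :
    ∃ w, w ≠ a ∧ G.Adj v w ∧ G.Adj a w := by
  obtain ⟨a', ha, b, hb, h1, h2⟩ := robust_out G hrob v {a} ⟨a, by simp⟩ (by simpa using h) (by simp)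
  simp at ha hb
  subst ha
  exact ⟨b, hb, h1, h2⟩

theorem Lab5.perm {G : SimpleGraph V} {v x y z p q x' y' z' p' q' : V} (h : Lab5 G v x y z p q)
    (hp : [x, y, z, p, q].Perm [x', y', z', p', q']) : Lab5 G v x' y' z' p' q' := by
  refine ⟨hp.nodup_iff.1 h.1, fun w => ?_⟩
  have := hp.mem_iff (a := w)
  simp only [List.mem_cons, List.not_mem_nil, or_false] at this
  rw [h.2, this]

theorem Lab6.perm {G : SimpleGraph V} {v x y z p q r x' y' z' p' q' r' : V} (h : Lab6 G v x y z p q r)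
    (hp : [x, y, z, p, q, r].Perm [x', y', z', p', q', r']) : Lab6 G v x' y' z' p' q' r' := by
  refine ⟨hp.nodup_iff.1 h.1, fun w => ?_⟩
  have := hp.mem_iff (a := w)
  simp only [List.mem_cons, List.not_mem_nil, or_false] at this
  rw [h.2, this]

theorem five [DecidableEq V] {G : SimpleGraph V} (hrob : Robust G) {v x y z p q : V}
    (h : Lab5 G v x y z p q)  (nxz : ¬ G.Adj x z) (nyz : ¬ G.Adj y z) :
    ReducibleVertexSet G {v} := by
  by_contra hR
  have : G.Adj x y → G.Adj z p → False := fun hxy hzp => hR (one5a h hxy hzp nxz nyz)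
  have : G.Adj x y → G.Adj z q → False := fun hxy hzq => hR (one5a (show Lab5 G v x y z q p from h.perm (by grind)) hxy hzq nxz nyz)
  have : G.Adj x y → G.Adj p q → False := fun hxy hpq => hR (one5b h hxy hpq nxz nyz)
  by_cases hxy : G.Adj x y
  · have nzp : ¬ G.Adj z p := by tauto
    have nzq : ¬ G.Adj z q := by tauto
    have npq : ¬ G.Adj p q := by tauto
    obtain ⟨w, hw1, hw2, hw3⟩ := nbr hrob h.adj_z
    rcases (h.2 w).1 hw2 with rfl | rfl | rfl | rfl | rfl
    · exact nxz hw3.symm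
    · exact nyz hw3.symm
    · exact hw1 rfl
    · exact nzp hw3
    · exact nzq hw3
  · have nxy := hxy
    have nbx : G.Adj x p ∨ G.Adj x q := by
      obtain ⟨w, hw1, hw2, hw3⟩ := nbr hrob h.adj_x
      rcases (h.2 w).1 hw2 with rfl | rfl | rfl | rfl | rfl
      · exact absurd rfl hw1
      · exact absurd hw3 nxy
      · exact absurd hw3 nxz
      · tauto
      · tauto
    have nby : G.Adj y p ∨ G.Adj y q := by
      obtain ⟨w, hw1, hw2, hw3⟩ := nbr hrob h.adj_y
      rcases (h.2 w).1 hw2 with rfl | rfl | rfl | rfl | rfl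
      · exact absurd hw3.symm nxy
      · exact absurd rfl hw1
      · exact absurd hw3 nyz
      · tauto
      · tauto
    have nbz : G.Adj z p ∨ G.Adj z q := by
      obtain ⟨w, hw1, hw2, hw3⟩ := nbr hrob h.adj_z
      rcases (h.2 w).1 hw2 with rfl | rfl | rfl | rfl | rfl
      · exact absurd hw3.symm nxz
      · exact absurd hw3.symm nyz
      · exact absurd rfl hw1
      · tauto
      · tauto
    have : G.Adj x p → G.Adj y q → False := fun hxp hyq => hR (cov5 h hxp hyq nxy nxz nyz)
    have : G.Adj x p → G.Adj z q → False := fun hxp hzq => hR (cov5 (show Lab5 G v x z y p q from h.perm (by grind)) hxp hzq nxz nxy (fun t => nyz t.symm))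
    have : G.Adj y p → G.Adj x q → False := fun hyp hxq => hR (cov5 (show Lab5 G v y x z p q from h.perm (by grind)) hyp hxq (fun t => nxy t.symm) nyz nxz)
    have : G.Adj y p → G.Adj z q → False := fun hyp hzq => hR (cov5 (show Lab5 G v y z x p q from h.perm (by grind)) hyp hzq nyz (fun t => nxy t.symm) (fun t => nxz t.symm))
    have : G.Adj z p → G.Adj x q → False := fun hzp hxq => hR (cov5 (show Lab5 G v z x y p q from h.perm (by grind)) hzp hxq (fun t => nxz t.symm) (fun t => nyz t.symm) nxy)
    have : G.Adj z p → G.Adj y q → False := fun hzp hyq => hR (cov5 (show Lab5 G v z y x p q from h.perm (by grind)) hzp hyq (fun t => nyz t.symm) (fun t => nxz t.symm) (fun t => nxy t.symm))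
    have : G.Adj x p → ¬ G.Adj x q → ¬ G.Adj y q → ¬ G.Adj z q → False := fun hxp nxq nyq nzq => hR (star5 h hxp.symm nxy nxz nxq nyz nyq nzq)
    have : G.Adj x q → ¬ G.Adj x p → ¬ G.Adj y p → ¬ G.Adj z p → False := fun hxq nxp nyp nzp => hR (star5 (show Lab5 G v x y z q p from h.perm (by grind)) hxq.symm nxy nxz nxp nyz nyp nzp)
    grind

theorem pendant [DecidableEq V] {G : SimpleGraph V} (hrob : Robust G) {v x y z p q r : V}
    (h : Lab6 G v x y z p q r)  (nxy : ¬ G.Adj x y) (nxz : ¬ G.Adj x z) (nxq : ¬ G.Adj x q) (nxr : ¬ G.Adj x r) (nyz : ¬ G.Adj y z) (nyq : ¬ G.Adj y q) (nyr : ¬ G.Adj y r) :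
    ReducibleVertexSet G {v} := by
  by_contra hR
  have hxp : G.Adj x p := by
    obtain ⟨w, hw1, hw2, hw3⟩ := nbr hrob h.adj_x
    rcases (h.2 w).1 hw2 with rfl | rfl | rfl | rfl | rfl | rfl
    · exact absurd rfl hw1
    · exact absurd hw3 nxy
    · exact absurd hw3 nxz
    · tauto
    · exact absurd hw3 nxq
    · exact absurd hw3 nxr
  have : G.Adj z q → False := fun hzq => hR (pend6 h hxp hzq nxy nxz nxq nxr nyz nyq nyr)
  have : G.Adj z r → False := fun hzr => hR (pend6 (show Lab6 G v x y z p r q from h.perm (by grind)) hxp hzr nxy nxz nxr nxq nyz nyr nyq)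
  have : G.Adj q r → False := fun hqr => hR (pend6 (show Lab6 G v x y q p r z from h.perm (by grind)) hxp hqr nxy nxq nxr nxz nyq nyr nyz)
  have : ¬ G.Adj z q → ¬ G.Adj z r → ¬ G.Adj q r → False := fun nzq nzr nqr => hR (star6 h hxp.symm nxy nxz nxq nxr nyz nyq nyr nzq nzr nqr)
  grind

theorem cover2 [DecidableEq V] {G : SimpleGraph V} (hrob : Robust G) {v x y z p q r : V}
    (h : Lab6 G v x y z p q r)  (nxy : ¬ G.Adj x y) (nxz : ¬ G.Adj x z) (nxr : ¬ G.Adj x r) (nyz : ¬ G.Adj y z) (nyr : ¬ G.Adj y r) (nzr : ¬ G.Adj z r) :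
    ReducibleVertexSet G {v} := by
  by_contra hR
  have nbx : G.Adj x p ∨ G.Adj x q := by
    obtain ⟨w, hw1, hw2, hw3⟩ := nbr hrob h.adj_x
    rcases (h.2 w).1 hw2 with rfl | rfl | rfl | rfl | rfl | rfl
    · exact absurd rfl hw1
    · exact absurd hw3 nxy
    · exact absurd hw3 nxz
    · tauto
    · tauto
    · exact absurd hw3 nxr
  have nby : G.Adj y p ∨ G.Adj y q := by
    obtain ⟨w, hw1, hw2, hw3⟩ := nbr hrob h.adj_y
    rcases (h.2 w).1 hw2 with rfl | rfl | rfl | rfl | rfl | rfl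
    · exact absurd hw3.symm nxy
    · exact absurd rfl hw1
    · exact absurd hw3 nyz
    · tauto
    · tauto
    · exact absurd hw3 nyr
  have nbz : G.Adj z p ∨ G.Adj z q := by
    obtain ⟨w, hw1, hw2, hw3⟩ := nbr hrob h.adj_z
    rcases (h.2 w).1 hw2 with rfl | rfl | rfl | rfl | rfl | rfl
    · exact absurd hw3.symm nxz
    · exact absurd hw3.symm nyz
    · exact absurd rfl hw1
    · tauto
    · tauto
    · exact absurd hw3 nzr
  have nbr : G.Adj p r ∨ G.Adj q r := by
    obtain ⟨w, hw1, hw2, hw3⟩ := nbr hrob h.adj_r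
    rcases (h.2 w).1 hw2 with rfl | rfl | rfl | rfl | rfl | rfl
    · exact absurd hw3.symm nxr
    · exact absurd hw3.symm nyr
    · exact absurd hw3.symm nzr
    · have := hw3.symm; tauto
    · have := hw3.symm; tauto
    · exact absurd rfl hw1
  have : G.Adj x p → G.Adj y q → False := fun hxp hyq => hR (cov6 h hxp hyq nxy nxz nxr nyz nyr nzr)
  have : G.Adj x p → G.Adj z q → False := fun hxp hzq => hR (cov6 (show Lab6 G v x z y p q r from h.perm (by grind)) hxp hzq nxz nxy nxr (fun t => nyz t.symm) nzr nyr)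
  have : G.Adj x p → G.Adj q r → False := fun hxp hqr => hR (cov6 (show Lab6 G v x r y p q z from h.perm (by grind)) hxp hqr.symm nxr nxy nxz (fun t => nyr t.symm) (fun t => nzr t.symm) nyz)
  have : G.Adj y p → G.Adj x q → False := fun hyp hxq => hR (cov6 (show Lab6 G v y x z p q r from h.perm (by grind)) hyp hxq (fun t => nxy t.symm) nyz nyr nxz nxr nzr)
  have : G.Adj y p → G.Adj z q → False := fun hyp hzq => hR (cov6 (show Lab6 G v y z x p q r from h.perm (by grind)) hyp hzq nyz (fun t => nxy t.symm) nyr (fun t => nxz t.symm) nzr nxr)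
  have : G.Adj y p → G.Adj q r → False := fun hyp hqr => hR (cov6 (show Lab6 G v y r x p q z from h.perm (by grind)) hyp hqr.symm nyr (fun t => nxy t.symm) nyz (fun t => nxr t.symm) (fun t => nzr t.symm) nxz)
  have : G.Adj z p → G.Adj x q → False := fun hzp hxq => hR (cov6 (show Lab6 G v z x y p q r from h.perm (by grind)) hzp hxq (fun t => nxz t.symm) (fun t => nyz t.symm) nzr nxy nxr nyr)
  have : G.Adj z p → G.Adj y q → False := fun hzp hyq => hR (cov6 (show Lab6 G v z y x p q r from h.perm (by grind)) hzp hyq (fun t => nyz t.symm) (fun t => nxz t.symm) nzr (fun t => nxy t.symm) nyr nxr)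
  have : G.Adj z p → G.Adj q r → False := fun hzp hqr => hR (cov6 (show Lab6 G v z r x p q y from h.perm (by grind)) hzp hqr.symm nzr (fun t => nxz t.symm) (fun t => nyz t.symm) (fun t => nxr t.symm) (fun t => nyr t.symm) nxy)
  have : G.Adj p r → G.Adj x q → False := fun hpr hxq => hR (cov6 (show Lab6 G v r x y p q z from h.perm (by grind)) hpr.symm hxq (fun t => nxr t.symm) (fun t => nyr t.symm) (fun t => nzr t.symm) nxy nxz nyz)
  have : G.Adj p r → G.Adj y q → False := fun hpr hyq => hR (cov6 (show Lab6 G v r y x p q z from h.perm (by grind)) hpr.symm hyq (fun t => nyr t.symm) (fun t => nxr t.symm) (fun t => nzr t.symm) (fun t => nxy t.symm) nyz nxz)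
  have : G.Adj p r → G.Adj z q → False := fun hpr hzq => hR (cov6 (show Lab6 G v r z x p q y from h.perm (by grind)) hpr.symm hzq (fun t => nzr t.symm) (fun t => nxr t.symm) (fun t => nyr t.symm) (fun t => nxz t.symm) (fun t => nyz t.symm) nxy)
  have : G.Adj x p → ¬ G.Adj x q → ¬ G.Adj y q → ¬ G.Adj z q → ¬ G.Adj q r → False := fun hxp nxq nyq nzq nqr => hR (star6 h hxp.symm nxy nxz nxq nxr nyz nyq nyr nzq nzr nqr)
  have : G.Adj x q → ¬ G.Adj x p → ¬ G.Adj y p → ¬ G.Adj z p → ¬ G.Adj p r → False := fun hxq nxp nyp nzp npr => hR (star6 (show Lab6 G v x y z q p r from h.perm (by grind)) hxq.symm nxy nxz nxp nxr nyz nyp nyr nzp nzr npr)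
  grind

theorem Ind6 [DecidableEq V] {G : SimpleGraph V} (hrob : Robust G) {v x y z p q r : V}
    (h : Lab6 G v x y z p q r)  (nxy : ¬ G.Adj x y) (nxz : ¬ G.Adj x z) (nyz : ¬ G.Adj y z) :
    ReducibleVertexSet G {v} := by
  by_contra hR
  have nbx : G.Adj x p ∨ G.Adj x q ∨ G.Adj x r := by
    obtain ⟨w, hw1, hw2, hw3⟩ := nbr hrob h.adj_x
    rcases (h.2 w).1 hw2 with rfl | rfl | rfl | rfl | rfl | rfl
    · exact absurd rfl hw1
    · exact absurd hw3 nxy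
    · exact absurd hw3 nxz
    · tauto
    · tauto
    · tauto
  have nby : G.Adj y p ∨ G.Adj y q ∨ G.Adj y r := by
    obtain ⟨w, hw1, hw2, hw3⟩ := nbr hrob h.adj_y
    rcases (h.2 w).1 hw2 with rfl | rfl | rfl | rfl | rfl | rfl
    · exact absurd hw3.symm nxy
    · exact absurd rfl hw1
    · exact absurd hw3 nyz
    · tauto
    · tauto
    · tauto
  have nbz : G.Adj z p ∨ G.Adj z q ∨ G.Adj z r := by
    obtain ⟨w, hw1, hw2, hw3⟩ := nbr hrob h.adj_z
    rcases (h.2 w).1 hw2 with rfl | rfl | rfl | rfl | rfl | rfl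
    · exact absurd hw3.symm nxz
    · exact absurd hw3.symm nyz
    · exact absurd rfl hw1
    · tauto
    · tauto
    · tauto
  have : G.Adj x p → G.Adj y q → G.Adj z r → False := fun hxp hyq hzr => hR (ind6 h hxp hyq hzr nxy nxz nyz)
  have : G.Adj x p → G.Adj y r → G.Adj z q → False := fun hxp hyr hzq => hR (ind6 (show Lab6 G v x y z p r q from h.perm (by grind)) hxp hyr hzq nxy nxz nyz)
  have : G.Adj x q → G.Adj y p → G.Adj z r → False := fun hxq hyp hzr => hR (ind6 (show Lab6 G v x y z q p r from h.perm (by grind)) hxq hyp hzr nxy nxz nyz)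
  have : G.Adj x q → G.Adj y r → G.Adj z p → False := fun hxq hyr hzp => hR (ind6 (show Lab6 G v x y z q r p from h.perm (by grind)) hxq hyr hzp nxy nxz nyz)
  have : G.Adj x r → G.Adj y p → G.Adj z q → False := fun hxr hyp hzq => hR (ind6 (show Lab6 G v x y z r p q from h.perm (by grind)) hxr hyp hzq nxy nxz nyz)
  have : G.Adj x r → G.Adj y q → G.Adj z p → False := fun hxr hyq hzp => hR (ind6 (show Lab6 G v x y z r q p from h.perm (by grind)) hxr hyq hzp nxy nxz nyz)
  have : ¬ G.Adj x q → ¬ G.Adj x r → ¬ G.Adj y q → ¬ G.Adj y r → False := fun nxq nxr nyq nyr => hR (pendant hrob h nxy nxz nxq nxr nyz nyq nyr)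
  have : ¬ G.Adj x p → ¬ G.Adj x r → ¬ G.Adj y p → ¬ G.Adj y r → False := fun nxp nxr nyp nyr => hR (pendant hrob (show Lab6 G v x y z q p r from h.perm (by grind)) nxy nxz nxp nxr nyz nyp nyr)
  have : ¬ G.Adj x p → ¬ G.Adj x q → ¬ G.Adj y p → ¬ G.Adj y q → False := fun nxp nxq nyp nyq => hR (pendant hrob (show Lab6 G v x y z r p q from h.perm (by grind)) nxy nxz nxp nxq nyz nyp nyq)
  have : ¬ G.Adj x q → ¬ G.Adj x r → ¬ G.Adj z q → ¬ G.Adj z r → False := fun nxq nxr nzq nzr => hR (pendant hrob (show Lab6 G v x z y p q r from h.perm (by grind)) nxz nxy nxq nxr (fun t => nyz t.symm) nzq nzr)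
  have : ¬ G.Adj x p → ¬ G.Adj x r → ¬ G.Adj z p → ¬ G.Adj z r → False := fun nxp nxr nzp nzr => hR (pendant hrob (show Lab6 G v x z y q p r from h.perm (by grind)) nxz nxy nxp nxr (fun t => nyz t.symm) nzp nzr)
  have : ¬ G.Adj x p → ¬ G.Adj x q → ¬ G.Adj z p → ¬ G.Adj z q → False := fun nxp nxq nzp nzq => hR (pendant hrob (show Lab6 G v x z y r p q from h.perm (by grind)) nxz nxy nxp nxq (fun t => nyz t.symm) nzp nzq)
  have : ¬ G.Adj y q → ¬ G.Adj y r → ¬ G.Adj z q → ¬ G.Adj z r → False := fun nyq nyr nzq nzr => hR (pendant hrob (show Lab6 G v y z x p q r from h.perm (by grind)) nyz (fun t => nxy t.symm) nyq nyr (fun t => nxz t.symm) nzq nzr)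
  have : ¬ G.Adj y p → ¬ G.Adj y r → ¬ G.Adj z p → ¬ G.Adj z r → False := fun nyp nyr nzp nzr => hR (pendant hrob (show Lab6 G v y z x q p r from h.perm (by grind)) nyz (fun t => nxy t.symm) nyp nyr (fun t => nxz t.symm) nzp nzr)
  have : ¬ G.Adj y p → ¬ G.Adj y q → ¬ G.Adj z p → ¬ G.Adj z q → False := fun nyp nyq nzp nzq => hR (pendant hrob (show Lab6 G v y z x r p q from h.perm (by grind)) nyz (fun t => nxy t.symm) nyp nyq (fun t => nxz t.symm) nzp nzq)
  have : ¬ G.Adj x r → ¬ G.Adj y r → ¬ G.Adj z r → False := fun nxr nyr nzr => hR (cover2 hrob h nxy nxz nxr nyz nyr nzr)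
  have : ¬ G.Adj x q → ¬ G.Adj y q → ¬ G.Adj z q → False := fun nxq nyq nzq => hR (cover2 hrob (show Lab6 G v x y z p r q from h.perm (by grind)) nxy nxz nxq nyz nyq nzq)
  have : ¬ G.Adj x p → ¬ G.Adj y p → ¬ G.Adj z p → False := fun nxp nyp nzp => hR (cover2 hrob (show Lab6 G v x y z q r p from h.perm (by grind)) nxy nxz nxp nyz nyp nzp)
  by_cases a1 : G.Adj x p <;> by_cases a2 : G.Adj x q <;> by_cases a3 : G.Adj x r <;>
    by_cases a4 : G.Adj y p <;> by_cases a5 : G.Adj y q <;> by_cases a6 : G.Adj y r <;> grind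

theorem lemB [DecidableEq V] {G : SimpleGraph V} (hrob : Robust G) {v x y z p q r : V}
    (h : Lab6 G v x y z p q r) (hxy : G.Adj x y) (hzp : G.Adj z p) (hzq : G.Adj z q) (nxz : ¬ G.Adj x z) (nyz : ¬ G.Adj y z) :
    ReducibleVertexSet G {v} := by
  by_contra hR
  have nqr : ¬ G.Adj q r := fun hqr => hR (one6 h hxy hzp hqr nxz nyz)
  have npr : ¬ G.Adj p r := fun hpr => hR (one6 (show Lab6 G v x y z q p r from h.perm (by grind)) hxy hzq hpr nxz nyz)
  have hpq : G.Adj p q := by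
    by_contra npq
    exact hR (Ind6 hrob (show Lab6 G v p q r x y z from h.perm (by grind)) npq npr nqr)
  have nzr : ¬ G.Adj z r := fun hzr => hR (one6 (show Lab6 G v x y z r p q from h.perm (by grind)) hxy hzr hpq nxz nyz)
  have hxr : G.Adj x r := by
    by_contra nxr
    exact hR (Ind6 hrob (show Lab6 G v x z r y p q from h.perm (by grind)) nxz nxr nzr)
  have hyr : G.Adj y r := by
    by_contra nyr
    exact hR (Ind6 hrob (show Lab6 G v y z r x p q from h.perm (by grind)) nyz nyr nzr)
  have nyq : ¬ G.Adj y q := fun hyq => hR (one6 (show Lab6 G v x r z p y q from h.perm (by grind)) hxr hzp hyq nxz (fun t => nzr t.symm))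
  have nyp : ¬ G.Adj y p := fun hyp => hR (one6 (show Lab6 G v x r z q y p from h.perm (by grind)) hxr hzq hyp nxz (fun t => nzr t.symm))
  have nxq : ¬ G.Adj x q := fun hxq => hR (one6 (show Lab6 G v y r z p x q from h.perm (by grind)) hyr hzp hxq nyz (fun t => nzr t.symm))
  have nxp : ¬ G.Adj x p := fun hxp => hR (one6 (show Lab6 G v y r z q x p from h.perm (by grind)) hyr hzq hxp nyz (fun t => nzr t.symm))
  obtain ⟨a, ha, b, hb, h1, h2⟩ := robust_out G hrob v {x, y, r} ⟨x, by simp⟩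
    (by simp [h.adj_x, h.adj_y, h.adj_r]) (le_trans Finset.card_le_three (by norm_num))
  simp only [Finset.mem_insert, Finset.mem_singleton] at ha hb
  have e1 := (h.2 b).1 h1
  have nrp : ¬ G.Adj r p := fun t => npr t.symm
  have nrq : ¬ G.Adj r q := fun t => nqr t.symm
  have nrz : ¬ G.Adj r z := fun t => nzr t.symm
  grind

theorem lemC [DecidableEq V] {G : SimpleGraph V} (hrob : Robust G) {v x y z p q r : V}
    (h : Lab6 G v x y z p q r) (hxy : G.Adj x y) (hzp : G.Adj z p) (nxz : ¬ G.Adj x z) (nyz : ¬ G.Adj y z) :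
    ReducibleVertexSet G {v} := by
  by_contra hR
  have nqr : ¬ G.Adj q r := fun hqr => hR (one6 h hxy hzp hqr nxz nyz)
  have : G.Adj z q → False := fun hzq => hR (lemB hrob h hxy hzp hzq nxz nyz)
  have : G.Adj z r → False := fun hzr => hR (lemB hrob (show Lab6 G v x y z p r q from h.perm (by grind)) hxy hzp hzr nxz nyz)
  have : ¬ G.Adj z q → ¬ G.Adj z r → False := fun nzq nzr => hR (Ind6 hrob (show Lab6 G v z q r x y p from h.perm (by grind)) nzq nzr nqr)
  tauto

theorem six [DecidableEq V] {G : SimpleGraph V} (hrob : Robust G) {v x y z p q r : V}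
    (h : Lab6 G v x y z p q r)  (nxz : ¬ G.Adj x z) (nyz : ¬ G.Adj y z) :
    ReducibleVertexSet G {v} := by
  by_contra hR
  have nbz : G.Adj z p ∨ G.Adj z q ∨ G.Adj z r := by
    obtain ⟨w, hw1, hw2, hw3⟩ := nbr hrob h.adj_z
    rcases (h.2 w).1 hw2 with rfl | rfl | rfl | rfl | rfl | rfl
    · exact absurd hw3.symm nxz
    · exact absurd hw3.symm nyz
    · exact absurd rfl hw1
    · tauto
    · tauto
    · tauto
  have : G.Adj x y → G.Adj z p → False := fun hxy hzp => hR (lemC hrob h hxy hzp nxz nyz)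
  have : G.Adj x y → G.Adj z q → False := fun hxy hzq => hR (lemC hrob (show Lab6 G v x y z q p r from h.perm (by grind)) hxy hzq nxz nyz)
  have : G.Adj x y → G.Adj z r → False := fun hxy hzr => hR (lemC hrob (show Lab6 G v x y z r p q from h.perm (by grind)) hxy hzr nxz nyz)
  have : ¬ G.Adj x y → False := fun nxy => hR (Ind6 hrob h nxy nxz nyz)
  tauto

theorem near [Fintype V] [DecidableEq V] {G : SimpleGraph V} (hrob : Robust G) {v : V}
    (hv : (G.neighborSet v).ncard ≤ 6) (hR : ¬ ReducibleVertexSet G {v}) {x y z : V}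
    (hx : G.Adj v x) (hy : G.Adj v y) (hz : G.Adj v z) (xy : x ≠ y) (xz : x ≠ z) (yz : y ≠ z)
    (nxz : ¬ G.Adj x z) : G.Adj y z := by
  classical
  by_contra nyz
  have hcard : (G.neighborSet v).ncard = (G.neighborFinset v).card := by
    rw [← Set.ncard_coe_finset]; simp
  have h5 : 5 ≤ (G.neighborFinset v).card := by
    by_contra h
    obtain ⟨a, ha, b, hb, h1, h2⟩ := robust_out G hrob v (G.neighborFinset v) ⟨x, by simpa using hx⟩
      (by simp) (by omega)
    simp at hb
    exact hb h1
  have h6 : (G.neighborFinset v).card ≤ 6 := by omega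
  have hsub : ({x, y, z} : Finset V) ⊆ G.neighborFinset v := by
    intro w; simp; rintro (rfl | rfl | rfl) <;> assumption
  have h3 : ({x, y, z} : Finset V).card = 3 := Finset.card_eq_three.2 ⟨x, y, z, xy, xz, yz, rfl⟩
  have hd := Finset.card_sdiff_of_subset hsub
  have hmem : ∀ w, G.Adj v w ↔ w = x ∨ w = y ∨ w = z ∨ w ∈ G.neighborFinset v \ {x, y, z} := by
    intro w
    simp only [Finset.mem_sdiff, SimpleGraph.mem_neighborFinset, Finset.mem_insert, Finset.mem_singleton]
    grind
  have hni : ∀ w ∈ G.neighborFinset v \ {x, y, z}, w ≠ x ∧ w ≠ y ∧ w ≠ z := by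
    intro w hw
    simpa using (Finset.mem_sdiff.1 hw).2
  rcases (by omega : (G.neighborFinset v \ {x, y, z}).card = 2 ∨
    (G.neighborFinset v \ {x, y, z}).card = 3) with h | h
  · obtain ⟨p, q, hpq, he⟩ := Finset.card_eq_two.1 h
    rw [he] at hmem hni
    simp at hni hmem
    exact hR (five hrob (x := x) (y := y) (z := z) (p := p) (q := q) ⟨by simp; grind, hmem⟩ nxz nyz)
  · obtain ⟨p, q, r, hpq, hpr, hqr, he⟩ := Finset.card_eq_three.1 h
    rw [he] at hmem hni
    simp at hni hmem
    exact hR (six hrob (x := x) (y := y) (z := z) (p := p) (q := q) (r := r) ⟨by simp; grind, hmem⟩ nxz nyz)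

theorem pairA [DecidableEq V] {G : SimpleGraph V} {u v p q a b c : V} (hnd : [u, v, p, q, a, b, c].Nodup)
    (hu : ∀ w, G.Adj u w → w ∈ [u, v, p, q, a, b, c]) (hv : ∀ w, G.Adj v w → w ∈ [u, v, p, q, a, b, c])
    (hvp : G.Adj v p) (hva : G.Adj v a) (hpa : G.Adj p a) (hvb : G.Adj v b) (hvc : G.Adj v c) (hbc : G.Adj b c) (huq : G.Adj u q) (hub : G.Adj u b) (hqb : G.Adj q b) (hua : G.Adj u a) (huc : G.Adj u c) (hac : G.Adj a c)
    (nup : ¬ G.Adj u p) (nvq : ¬ G.Adj v q) :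
    ReducibleVertexSet G {u, v} := by
  have := cert G ![u, v, p, q, a, b, c] [0, 1] [(1, 2, 4), (1, 5, 6), (0, 3, 5), (0, 4, 6)]
    [(2, 4), (5, 6), (3, 5), (4, 6), (0, 1), (1, 2), (0, 3), (4, 5)] [(0, 2), (1, 3)] (by decide)
    (by rw [← List.nodup_ofFn]; simpa using hnd) (by simp [hvp, hva, hpa, hvb, hvc, hbc, huq, hub, hqb, hua, huc, hac])
    (by simp [nup, nvq]) (by
      have key : ∀ w, w ∈ [u, v, p, q, a, b, c] → ∃ j, ![u, v, p, q, a, b, c] j = w := by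
        intro w hw
        simp only [List.mem_cons, List.not_mem_nil, or_false] at hw
        rcases hw with rfl | rfl | rfl | rfl | rfl | rfl | rfl
        · exact ⟨0, rfl⟩
        · exact ⟨1, rfl⟩
        · exact ⟨2, rfl⟩
        · exact ⟨3, rfl⟩
        · exact ⟨4, rfl⟩
        · exact ⟨5, rfl⟩
        · exact ⟨6, rfl⟩
      intro i hi w hw
      simp only [List.mem_cons, List.not_mem_nil, or_false] at hi
      rcases hi with rfl | rfl
      · exact key w (hu w hw)
      · exact key w (hv w hw))
  simpa using this

theorem pairB0 [DecidableEq V] {G : SimpleGraph V} {u v a b c d : V} (hnd : [u, v, a, b, c, d].Nodup)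
    (hu : ∀ w, G.Adj u w → w ∈ [u, v, a, b, c, d]) (hv : ∀ w, G.Adj v w → w ∈ [u, v, a, b, c, d])
    (hua : G.Adj u a) (hub : G.Adj u b) (hab : G.Adj a b) (huc : G.Adj u c) (hud : G.Adj u d) (hcd : G.Adj c d) (hvb : G.Adj v b) (hvc : G.Adj v c) (hbc : G.Adj b c) (hva : G.Adj v a) (hvd : G.Adj v d) (had : G.Adj a d)
     :
    ReducibleVertexSet G {u, v} := by
  have := cert G ![u, v, a, b, c, d] [0, 1] [(0, 2, 3), (0, 4, 5), (1, 3, 4), (1, 2, 5)]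
    [(2, 3), (2, 4), (2, 5), (3, 4), (3, 5), (4, 5), (0, 1)] [] (by decide)
    (by rw [← List.nodup_ofFn]; simpa using hnd) (by simp [hua, hub, hab, huc, hud, hcd, hvb, hvc, hbc, hva, hvd, had])
    (by simp []) (by
      have key : ∀ w, w ∈ [u, v, a, b, c, d] → ∃ j, ![u, v, a, b, c, d] j = w := by
        intro w hw
        simp only [List.mem_cons, List.not_mem_nil, or_false] at hw
        rcases hw with rfl | rfl | rfl | rfl | rfl | rfl
        · exact ⟨0, rfl⟩
        · exact ⟨1, rfl⟩
        · exact ⟨2, rfl⟩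
        · exact ⟨3, rfl⟩
        · exact ⟨4, rfl⟩
        · exact ⟨5, rfl⟩
      intro i hi w hw
      simp only [List.mem_cons, List.not_mem_nil, or_false] at hi
      rcases hi with rfl | rfl
      · exact key w (hu w hw)
      · exact key w (hv w hw))
  simpa using this

theorem pairB1 [DecidableEq V] {G : SimpleGraph V} {u v p a b c d : V} (hnd : [u, v, p, a, b, c, d].Nodup)
    (hu : ∀ w, G.Adj u w → w ∈ [u, v, p, a, b, c, d]) (hv : ∀ w, G.Adj v w → w ∈ [u, v, p, a, b, c, d])
    (hua : G.Adj u a) (hub : G.Adj u b) (hab : G.Adj a b) (huc : G.Adj u c) (hud : G.Adj u d) (hcd : G.Adj c d) (hvb : G.Adj v b) (hvc : G.Adj v c) (hbc : G.Adj b c) (hva : G.Adj v a) (hvd : G.Adj v d) (had : G.Adj a d)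
    (nup : ¬ G.Adj u p) :
    ReducibleVertexSet G {u, v} := by
  have := cert G ![u, v, p, a, b, c, d] [0, 1] [(0, 3, 4), (0, 5, 6), (1, 4, 5), (1, 3, 6)]
    [(3, 4), (3, 5), (3, 6), (4, 5), (4, 6), (5, 6), (0, 1), (1, 2)] [(0, 2)] (by decide)
    (by rw [← List.nodup_ofFn]; simpa using hnd) (by simp [hua, hub, hab, huc, hud, hcd, hvb, hvc, hbc, hva, hvd, had])
    (by simp [nup]) (by
      have key : ∀ w, w ∈ [u, v, p, a, b, c, d] → ∃ j, ![u, v, p, a, b, c, d] j = w := by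
        intro w hw
        simp only [List.mem_cons, List.not_mem_nil, or_false] at hw
        rcases hw with rfl | rfl | rfl | rfl | rfl | rfl | rfl
        · exact ⟨0, rfl⟩
        · exact ⟨1, rfl⟩
        · exact ⟨2, rfl⟩
        · exact ⟨3, rfl⟩
        · exact ⟨4, rfl⟩
        · exact ⟨5, rfl⟩
        · exact ⟨6, rfl⟩
      intro i hi w hw
      simp only [List.mem_cons, List.not_mem_nil, or_false] at hi
      rcases hi with rfl | rfl
      · exact key w (hu w hw)
      · exact key w (hv w hw))
  simpa using this

theorem pairB2 [DecidableEq V] {G : SimpleGraph V} {u v p q a b c d : V} (hnd : [u, v, p, q, a, b, c, d].Nodup)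
    (hu : ∀ w, G.Adj u w → w ∈ [u, v, p, q, a, b, c, d]) (hv : ∀ w, G.Adj v w → w ∈ [u, v, p, q, a, b, c, d])
    (hua : G.Adj u a) (hub : G.Adj u b) (hab : G.Adj a b) (huc : G.Adj u c) (hud : G.Adj u d) (hcd : G.Adj c d) (hvb : G.Adj v b) (hvc : G.Adj v c) (hbc : G.Adj b c) (hva : G.Adj v a) (hvd : G.Adj v d) (had : G.Adj a d)
    (nup : ¬ G.Adj u p) (nvq : ¬ G.Adj v q) (nac : ¬ G.Adj a c) :
    ReducibleVertexSet G {u, v} := by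
  have := cert G ![u, v, p, q, a, b, c, d] [0, 1] [(0, 4, 5), (0, 6, 7), (1, 5, 6), (1, 4, 7)]
    [(4, 5), (4, 7), (5, 6), (5, 7), (6, 7), (0, 1), (1, 2), (0, 3)] [(0, 2), (1, 3), (4, 6)] (by decide)
    (by rw [← List.nodup_ofFn]; simpa using hnd) (by simp [hua, hub, hab, huc, hud, hcd, hvb, hvc, hbc, hva, hvd, had])
    (by simp [nup, nvq, nac]) (by
      have key : ∀ w, w ∈ [u, v, p, q, a, b, c, d] → ∃ j, ![u, v, p, q, a, b, c, d] j = w := by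
        intro w hw
        simp only [List.mem_cons, List.not_mem_nil, or_false] at hw
        rcases hw with rfl | rfl | rfl | rfl | rfl | rfl | rfl | rfl
        · exact ⟨0, rfl⟩
        · exact ⟨1, rfl⟩
        · exact ⟨2, rfl⟩
        · exact ⟨3, rfl⟩
        · exact ⟨4, rfl⟩
        · exact ⟨5, rfl⟩
        · exact ⟨6, rfl⟩
        · exact ⟨7, rfl⟩
      intro i hi w hw
      simp only [List.mem_cons, List.not_mem_nil, or_false] at hi
      rcases hi with rfl | rfl
      · exact key w (hu w hw)
      · exact key w (hv w hw))
  simpa using this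

theorem pairB3 [DecidableEq V] {G : SimpleGraph V} {u v p q a b c d : V} (hnd : [u, v, p, q, a, b, c, d].Nodup)
    (hu : ∀ w, G.Adj u w → w ∈ [u, v, p, q, a, b, c, d]) (hv : ∀ w, G.Adj v w → w ∈ [u, v, p, q, a, b, c, d])
    (hvp : G.Adj v p) (hva : G.Adj v a) (hpa : G.Adj p a) (hvb : G.Adj v b) (hvc : G.Adj v c) (hbc : G.Adj b c) (huv : G.Adj u v) (hud : G.Adj u d) (hvd : G.Adj v d) (huq : G.Adj u q) (hub : G.Adj u b) (hqb : G.Adj q b) (hua : G.Adj u a) (huc : G.Adj u c) (hac : G.Adj a c)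
    (nup : ¬ G.Adj u p) (nvq : ¬ G.Adj v q) :
    ReducibleVertexSet G {u, v} := by
  have := cert G ![u, v, p, q, a, b, c, d] [0, 1] [(1, 2, 4), (1, 5, 6), (0, 1, 7), (0, 3, 5), (0, 4, 6)]
    [(2, 4), (5, 6), (3, 5), (4, 6), (0, 1), (1, 2), (0, 3), (1, 7), (0, 7), (4, 5)] [(0, 2), (1, 3)] (by decide)
    (by rw [← List.nodup_ofFn]; simpa using hnd) (by simp [hvp, hva, hpa, hvb, hvc, hbc, huv, hud, hvd, huq, hub, hqb, hua, huc, hac])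
    (by simp [nup, nvq]) (by
      have key : ∀ w, w ∈ [u, v, p, q, a, b, c, d] → ∃ j, ![u, v, p, q, a, b, c, d] j = w := by
        intro w hw
        simp only [List.mem_cons, List.not_mem_nil, or_false] at hw
        rcases hw with rfl | rfl | rfl | rfl | rfl | rfl | rfl | rfl
        · exact ⟨0, rfl⟩
        · exact ⟨1, rfl⟩
        · exact ⟨2, rfl⟩
        · exact ⟨3, rfl⟩
        · exact ⟨4, rfl⟩
        · exact ⟨5, rfl⟩
        · exact ⟨6, rfl⟩
        · exact ⟨7, rfl⟩
      intro i hi w hw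
      simp only [List.mem_cons, List.not_mem_nil, or_false] at hi
      rcases hi with rfl | rfl
      · exact key w (hu w hw)
      · exact key w (hv w hw))
  simpa using this

theorem pairC0 [DecidableEq V] {G : SimpleGraph V} {u v a b c d e : V} (hnd : [u, v, a, b, c, d, e].Nodup)
    (hu : ∀ w, G.Adj u w → w ∈ [u, v, a, b, c, d, e]) (hv : ∀ w, G.Adj v w → w ∈ [u, v, a, b, c, d, e])
    (hua : G.Adj u a) (hub : G.Adj u b) (hab : G.Adj a b) (huc : G.Adj u c) (hud : G.Adj u d) (hcd : G.Adj c d) (huv : G.Adj u v) (hue : G.Adj u e) (hve : G.Adj v e) (hva : G.Adj v a) (hvc : G.Adj v c) (hac : G.Adj a c) (hvb : G.Adj v b) (hvd : G.Adj v d) (hbd : G.Adj b d) (hea : G.Adj e a) (hed : G.Adj e d) (had : G.Adj a d) (heb : G.Adj e b) (hec : G.Adj e c) (hbc : G.Adj b c)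
     :
    ReducibleVertexSet G {u, v} := by
  have := cert G ![u, v, a, b, c, d, e] [0, 1] [(0, 2, 3), (0, 4, 5), (0, 1, 6), (1, 2, 4), (1, 3, 5), (6, 2, 5), (6, 3, 4)]
    [(2, 3), (2, 4), (2, 5), (2, 6), (3, 4), (3, 5), (3, 6), (4, 5), (4, 6), (5, 6), (0, 1)] [] (by decide)
    (by rw [← List.nodup_ofFn]; simpa using hnd) (by simp [hua, hub, hab, huc, hud, hcd, huv, hue, hve, hva, hvc, hac, hvb, hvd, hbd, hea, hed, had, heb, hec, hbc])
    (by simp []) (by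
      have key : ∀ w, w ∈ [u, v, a, b, c, d, e] → ∃ j, ![u, v, a, b, c, d, e] j = w := by
        intro w hw
        simp only [List.mem_cons, List.not_mem_nil, or_false] at hw
        rcases hw with rfl | rfl | rfl | rfl | rfl | rfl | rfl
        · exact ⟨0, rfl⟩
        · exact ⟨1, rfl⟩
        · exact ⟨2, rfl⟩
        · exact ⟨3, rfl⟩
        · exact ⟨4, rfl⟩
        · exact ⟨5, rfl⟩
        · exact ⟨6, rfl⟩
      intro i hi w hw
      simp only [List.mem_cons, List.not_mem_nil, or_false] at hi
      rcases hi with rfl | rfl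
      · exact key w (hu w hw)
      · exact key w (hv w hw))
  simpa using this

theorem pairC1 [DecidableEq V] {G : SimpleGraph V} {u v a b c d e : V} (hnd : [u, v, a, b, c, d, e].Nodup)
    (hu : ∀ w, G.Adj u w → w ∈ [u, v, a, b, c, d, e]) (hv : ∀ w, G.Adj v w → w ∈ [u, v, a, b, c, d, e])
    (huc : G.Adj u c) (hud : G.Adj u d) (hcd : G.Adj c d) (huv : G.Adj u v) (hue : G.Adj u e) (hve : G.Adj v e) (hva : G.Adj v a) (hvc : G.Adj v c) (hac : G.Adj a c) (hvb : G.Adj v b) (hvd : G.Adj v d) (hbd : G.Adj b d) (hea : G.Adj e a) (hed : G.Adj e d) (had : G.Adj a d) (heb : G.Adj e b) (hec : G.Adj e c) (hbc : G.Adj b c)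
     :
    ReducibleVertexSet G {u, v} := by
  have := cert G ![u, v, a, b, c, d, e] [0, 1] [(0, 4, 5), (0, 1, 6), (1, 2, 4), (1, 3, 5), (6, 2, 5), (6, 3, 4)]
    [(2, 3), (2, 4), (2, 5), (2, 6), (3, 4), (3, 5), (3, 6), (4, 5), (4, 6), (5, 6), (0, 1)] [] (by decide)
    (by rw [← List.nodup_ofFn]; simpa using hnd) (by simp [huc, hud, hcd, huv, hue, hve, hva, hvc, hac, hvb, hvd, hbd, hea, hed, had, heb, hec, hbc])
    (by simp []) (by
      have key : ∀ w, w ∈ [u, v, a, b, c, d, e] → ∃ j, ![u, v, a, b, c, d, e] j = w := by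
        intro w hw
        simp only [List.mem_cons, List.not_mem_nil, or_false] at hw
        rcases hw with rfl | rfl | rfl | rfl | rfl | rfl | rfl
        · exact ⟨0, rfl⟩
        · exact ⟨1, rfl⟩
        · exact ⟨2, rfl⟩
        · exact ⟨3, rfl⟩
        · exact ⟨4, rfl⟩
        · exact ⟨5, rfl⟩
        · exact ⟨6, rfl⟩
      intro i hi w hw
      simp only [List.mem_cons, List.not_mem_nil, or_false] at hi
      rcases hi with rfl | rfl
      · exact key w (hu w hw)
      · exact key w (hv w hw))
  simpa using this

theorem pairC2 [DecidableEq V] {G : SimpleGraph V} {u v a b c d e : V} (hnd : [u, v, a, b, c, d, e].Nodup)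
    (hu : ∀ w, G.Adj u w → w ∈ [u, v, a, b, c, d, e]) (hv : ∀ w, G.Adj v w → w ∈ [u, v, a, b, c, d, e])
    (huv : G.Adj u v) (hue : G.Adj u e) (hve : G.Adj v e) (hva : G.Adj v a) (hvc : G.Adj v c) (hac : G.Adj a c) (hvb : G.Adj v b) (hvd : G.Adj v d) (hbd : G.Adj b d) (hea : G.Adj e a) (hed : G.Adj e d) (had : G.Adj a d) (heb : G.Adj e b) (hec : G.Adj e c) (hbc : G.Adj b c)
    (nab : ¬ G.Adj a b) (ncd : ¬ G.Adj c d) :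
    ReducibleVertexSet G {u, v} := by
  have := cert G ![u, v, a, b, c, d, e] [0, 1] [(0, 1, 6), (1, 2, 4), (1, 3, 5), (6, 2, 5), (6, 3, 4)]
    [(2, 4), (2, 5), (2, 6), (3, 4), (3, 5), (3, 6), (4, 6), (5, 6), (0, 1)] [(2, 3), (4, 5)] (by decide)
    (by rw [← List.nodup_ofFn]; simpa using hnd) (by simp [huv, hue, hve, hva, hvc, hac, hvb, hvd, hbd, hea, hed, had, heb, hec, hbc])
    (by simp [nab, ncd]) (by
      have key : ∀ w, w ∈ [u, v, a, b, c, d, e] → ∃ j, ![u, v, a, b, c, d, e] j = w := by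
        intro w hw
        simp only [List.mem_cons, List.not_mem_nil, or_false] at hw
        rcases hw with rfl | rfl | rfl | rfl | rfl | rfl | rfl
        · exact ⟨0, rfl⟩
        · exact ⟨1, rfl⟩
        · exact ⟨2, rfl⟩
        · exact ⟨3, rfl⟩
        · exact ⟨4, rfl⟩
        · exact ⟨5, rfl⟩
        · exact ⟨6, rfl⟩
      intro i hi w hw
      simp only [List.mem_cons, List.not_mem_nil, or_false] at hi
      rcases hi with rfl | rfl
      · exact key w (hu w hw)
      · exact key w (hv w hw))
  simpa using this

theorem pairpick [DecidableEq V] {G : SimpleGraph V} (C : Finset V) (hc : 2 ≤ C.card)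
    (hn : ∀ x ∈ C, ∀ y ∈ C, ∀ z ∈ C, x ≠ y → x ≠ z → y ≠ z → ¬ G.Adj x z → G.Adj y z) :
    ∃ x ∈ C, ∃ y ∈ C, x ≠ y ∧ ∀ w ∈ C, w ≠ x → w ≠ y → G.Adj x w ∧ G.Adj y w := by
  by_cases h : ∃ x ∈ C, ∃ y ∈ C, x ≠ y ∧ ¬ G.Adj x y
  · obtain ⟨x, hx, y, hy, hxy, ha⟩ := h
    refine ⟨x, hx, y, hy, hxy, fun w hw h1 h2 => ⟨?_, ?_⟩⟩
    · exact (hn y hy w hw x hx h2.symm hxy.symm h1 (fun t => ha t.symm)).symm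
    · exact (hn x hx w hw y hy h1.symm hxy h2 ha).symm
  · push Not at h
    obtain ⟨x, hx, y, hy, hxy⟩ := Finset.one_lt_card.1 (by omega : 1 < C.card)
    exact ⟨x, hx, y, hy, hxy, fun w hw h1 h2 => ⟨h x hx w hw h1.symm, h y hy w hw h2.symm⟩⟩

theorem lab_three [DecidableEq V] {G : SimpleGraph V} (C : Finset V) (hc : C.card = 3)
    (hn : ∀ x ∈ C, ∀ y ∈ C, ∀ z ∈ C, x ≠ y → x ≠ z → y ≠ z → ¬ G.Adj x z → G.Adj y z) :
    ∃ a b c, C = {a, b, c} ∧ [a, b, c].Nodup ∧ G.Adj a c ∧ G.Adj b c := by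
  obtain ⟨x, hx, y, hy, hxy, h⟩ := pairpick C (by omega) hn
  have h1 : ((C.erase x).erase y).card = 1 := by
    rw [Finset.card_erase_of_mem (by simp [hy, hxy.symm]), Finset.card_erase_of_mem hx]; omega
  obtain ⟨c, hc⟩ := Finset.card_eq_one.1 h1
  have hC : C = {x, y, c} := by
    rw [← hc, Finset.insert_erase (by simp [hy, hxy.symm]), Finset.insert_erase hx]
  have hcm : c ∈ (C.erase x).erase y := by rw [hc]; simp
  simp only [Finset.mem_erase] at hcm
  refine ⟨x, y, c, hC, ?_, h c hcm.2.2 hcm.2.1 hcm.1⟩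
  simp; grind

theorem lab_four [DecidableEq V] {G : SimpleGraph V} (C : Finset V) (hc : C.card = 4)
    (hn : ∀ x ∈ C, ∀ y ∈ C, ∀ z ∈ C, x ≠ y → x ≠ z → y ≠ z → ¬ G.Adj x z → G.Adj y z) :
    ∃ a b c d, C = {a, b, c, d} ∧ [a, b, c, d].Nodup ∧
      G.Adj a b ∧ G.Adj b c ∧ G.Adj c d ∧ G.Adj a d := by
  obtain ⟨x, hx, y, hy, hxy, h⟩ := pairpick C (by omega) hn
  have h1 : ((C.erase x).erase y).card = 2 := by
    rw [Finset.card_erase_of_mem (by simp [hy, hxy.symm]), Finset.card_erase_of_mem hx]; omega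
  obtain ⟨c, d, hcd, hc⟩ := Finset.card_eq_two.1 h1
  have hC : C = {x, y, c, d} := by
    rw [← hc, Finset.insert_erase (by simp [hy, hxy.symm]), Finset.insert_erase hx]
  have hcm : c ∈ (C.erase x).erase y := by rw [hc]; simp
  have hdm : d ∈ (C.erase x).erase y := by rw [hc]; simp
  simp only [Finset.mem_erase] at hcm hdm
  have e1 := h c hcm.2.2 hcm.2.1 hcm.1
  have e2 := h d hdm.2.2 hdm.2.1 hdm.1
  refine ⟨x, c, y, d, ?_, ?_, e1.1, e1.2.symm, e2.2, e2.1⟩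
  · rw [hC]; ext w; simp; tauto
  · simp; grind

theorem lab_five [DecidableEq V] {G : SimpleGraph V} (C : Finset V) (hc : C.card = 5)
    (hn : ∀ x ∈ C, ∀ y ∈ C, ∀ z ∈ C, x ≠ y → x ≠ z → y ≠ z → ¬ G.Adj x z → G.Adj y z) :
    ∃ a b c d e, C = {a, b, c, d, e} ∧ [a, b, c, d, e].Nodup ∧
      G.Adj a c ∧ G.Adj a d ∧ G.Adj a e ∧ G.Adj b c ∧ G.Adj b d ∧ G.Adj b e ∧
      G.Adj c e ∧ G.Adj d e := by
  obtain ⟨x, hx, y, hy, hxy, h⟩ := pairpick C (by omega) hn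
  have h1 : ((C.erase x).erase y).card = 3 := by
    rw [Finset.card_erase_of_mem (by simp [hy, hxy.symm]), Finset.card_erase_of_mem hx]; omega
  have hsub : ∀ w ∈ (C.erase x).erase y, w ∈ C := fun w hw =>
    Finset.mem_of_mem_erase (Finset.mem_of_mem_erase hw)
  obtain ⟨c, d, e, hc, hnd, hce, hde⟩ := lab_three (G := G) _ h1
    (fun x hx y hy z hz => hn x (hsub x hx) y (hsub y hy) z (hsub z hz))
  have hC : C = {x, y, c, d, e} := by
    rw [← hc, Finset.insert_erase (by simp [hy, hxy.symm]), Finset.insert_erase hx]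
  have hcm : c ∈ (C.erase x).erase y := by rw [hc]; simp
  have hdm : d ∈ (C.erase x).erase y := by rw [hc]; simp
  have hem : e ∈ (C.erase x).erase y := by rw [hc]; simp
  simp only [Finset.mem_erase] at hcm hdm hem
  have e1 := h c hcm.2.2 hcm.2.1 hcm.1
  have e2 := h d hdm.2.2 hdm.2.1 hdm.1
  have e3 := h e hem.2.2 hem.2.1 hem.1
  refine ⟨x, y, c, d, e, hC, ?_, e1.1, e2.1, e3.1, e1.2, e2.2, e3.2, hce, hde⟩
  simp at hnd ⊢; grind

theorem outside [Fintype V] [DecidableEq V] {G : SimpleGraph V} (hrob : Robust G) {u v : V}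
    (huv : G.Adj u v) (hv : (G.neighborSet v).ncard ≤ 6) (hR : ¬ ReducibleVertexSet G {v})
    (C : Finset V) (hC : ∀ w, w ∈ C ↔ G.Adj u w ∧ G.Adj v w) :
    (∀ x ∈ C, ∀ y ∈ C, ∀ z ∈ C, x ≠ y → x ≠ z → y ≠ z → ¬ G.Adj x z → G.Adj y z) ∧
    (((C.card = 4 ∨ C.card = 5) ∧ ∀ w, G.Adj v w → w = u ∨ w ∈ C) ∨
     ((C.card = 3 ∨ C.card = 4) ∧ ∃ p, p ∉ C ∧ p ≠ u ∧ G.Adj v p ∧ ¬ G.Adj u p ∧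
        (∀ c ∈ C, G.Adj p c) ∧ ∀ w, G.Adj v w → w = u ∨ w = p ∨ w ∈ C)) := by
  classical
  refine ⟨fun x hx y hy z hz => near hrob hv hR ((hC x).1 hx).2 ((hC y).1 hy).2 ((hC z).1 hz).2, ?_⟩
  have huC : u ∉ C := fun h => G.loopless.irrefl _ ((hC u).1 h).1
  have hcard : (G.neighborSet v).ncard = (G.neighborFinset v).card := by
    rw [← Set.ncard_coe_finset]; simp
  have h5 : 5 ≤ (G.neighborFinset v).card := by
    by_contra h
    obtain ⟨a, ha, b, hb, h1, h2⟩ := robust_out G hrob v (G.neighborFinset v)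
      ⟨u, by simpa using huv.symm⟩ (by simp) (by omega)
    simp at hb
    exact hb h1
  by_cases hp : ∃ p, p ≠ u ∧ G.Adj v p ∧ ¬ G.Adj u p
  · right
    obtain ⟨p, hpu, hvp, hup⟩ := hp
    have hpC : p ∉ C := fun h => hup ((hC p).1 h).1
    have hall : ∀ w, G.Adj v w → w = u ∨ w = p ∨ w ∈ C := by
      intro w hw
      by_cases h1 : w = u
      · exact Or.inl h1
      by_cases h2 : w = p
      · exact Or.inr (Or.inl h2)
      right; right
      rw [hC]
      exact ⟨(near hrob hv hR hvp hw huv.symm (Ne.symm h2) hpu h1 (fun t => hup t.symm)).symm, hw⟩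
    have hN : G.neighborFinset v = insert u (insert p C) := by
      ext w
      simp only [SimpleGraph.mem_neighborFinset, Finset.mem_insert]
      refine ⟨hall w, ?_⟩
      rintro (rfl | rfl | h)
      · exact huv.symm
      · exact hvp
      · exact ((hC w).1 h).2
    rw [hN, Finset.card_insert_of_notMem (by simp [huC, hpu.symm]), Finset.card_insert_of_notMem hpC] at hcard h5
    refine ⟨by omega, p, hpC, hpu, hvp, hup, ?_, hall⟩
    intro c hc
    have hc' := (hC c).1 hc
    exact (near hrob hv hR huv.symm hc'.2 hvp hc'.1.ne hpu.symm (fun h => hpC (h ▸ hc)) hup).symm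
  · left
    push Not at hp
    have hall : ∀ w, G.Adj v w → w = u ∨ w ∈ C := by
      intro w hw
      by_cases h1 : w = u
      · exact Or.inl h1
      · right; rw [hC]; exact ⟨hp w h1 hw, hw⟩
    have hN : G.neighborFinset v = insert u C := by
      ext w
      simp only [SimpleGraph.mem_neighborFinset, Finset.mem_insert]
      refine ⟨hall w, ?_⟩
      rintro (rfl | h)
      · exact huv.symm
      · exact ((hC w).1 h).2
    rw [hN, Finset.card_insert_of_notMem huC] at hcard h5
    exact ⟨by omega, hall⟩

theorem caseB1 [DecidableEq V] {G : SimpleGraph V} {u v p : V} (huv : G.Adj u v) (C : Finset V)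
    (hC : ∀ w, w ∈ C ↔ G.Adj u w ∧ G.Adj v w)
    (hn : ∀ x ∈ C, ∀ y ∈ C, ∀ z ∈ C, x ≠ y → x ≠ z → y ≠ z → ¬ G.Adj x z → G.Adj y z)
    (hc : C.card = 4) (hpC : p ∉ C) (hpu : p ≠ u) (hvp : G.Adj v p) (hup : ¬ G.Adj u p)
    (hu : ∀ w, G.Adj u w → w = v ∨ w ∈ C) (hv : ∀ w, G.Adj v w → w = u ∨ w = p ∨ w ∈ C) :
    ReducibleVertexSet G {u, v} := by
  have huC : u ∉ C := fun h => G.loopless.irrefl _ ((hC u).1 h).1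
  have hvC : v ∉ C := fun h => G.loopless.irrefl _ ((hC v).1 h).2
  obtain ⟨a, b, c, d, he, hnd, h1, h2, h3, h4⟩ := lab_four C hc hn
  obtain ⟨ha, ha'⟩ := (hC a).1 (by simp [he])
  obtain ⟨hb, hb'⟩ := (hC b).1 (by simp [he])
  obtain ⟨hc, hc'⟩ := (hC c).1 (by simp [he])
  obtain ⟨hd, hd'⟩ := (hC d).1 (by simp [he])
  subst he
  have := huv.ne
  have := hvp.ne
  simp at hnd huC hvC hpC hu hv
  apply pairB1 (u := u) (v := v) (p := p) (a := a) (b := b) (c := c) (d := d) <;>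
    first | assumption | (apply SimpleGraph.Adj.symm; assumption) | (simp; grind)

set_option maxHeartbeats 1000000 in
theorem adjacent_low_degree_reducible [Fintype V] [DecidableEq V] (G : SimpleGraph V)
    (hrob : Robust G) (u v : V) (huv : G.Adj u v)
    (hu : (G.neighborSet u).ncard ≤ 6) (hv : (G.neighborSet v).ncard ≤ 6) :
    ReducibleVertexSet G {u} ∨ ReducibleVertexSet G {v} ∨
      ReducibleVertexSet G {u, v} := by
  classical
  by_cases hRu : ReducibleVertexSet G {u}
  · exact Or.inl hRu
  by_cases hRv : ReducibleVertexSet G {v}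
  · exact Or.inr (Or.inl hRv)
  right; right
  obtain ⟨C, hC⟩ : ∃ C : Finset V, ∀ w, w ∈ C ↔ G.Adj u w ∧ G.Adj v w :=
    ⟨Finset.univ.filter (fun w => G.Adj u w ∧ G.Adj v w), by simp⟩
  have hC' : ∀ w, w ∈ C ↔ G.Adj v w ∧ G.Adj u w := fun w => (hC w).trans and_comm
  have huC : u ∉ C := fun h => G.loopless.irrefl _ ((hC u).1 h).1
  have hvC : v ∉ C := fun h => G.loopless.irrefl _ ((hC v).1 h).2
  have huvne := huv.ne
  obtain ⟨hn, hV⟩ := outside hrob huv hv hRv C hC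
  obtain ⟨-, hU⟩ := outside hrob huv.symm hu hRu C hC'
  rcases hV with ⟨hcV, hVall⟩ | ⟨hcV, p, hpC, hpu, hvp, hup, hpc, hVall⟩ <;>
    rcases hU with ⟨hcU, hUall⟩ | ⟨hcU, q, hqC, hqv, huq, hvq, hqc, hUall⟩
  · rcases hcV with hcV | hcV
    · obtain ⟨a, b, c, d, he, hnd, h1, h2, h3, h4⟩ := lab_four C hcV hn
      obtain ⟨ha, ha'⟩ := (hC a).1 (by simp [he])
      obtain ⟨hb, hb'⟩ := (hC b).1 (by simp [he])
      obtain ⟨hc, hc'⟩ := (hC c).1 (by simp [he])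
      obtain ⟨hd, hd'⟩ := (hC d).1 (by simp [he])
      subst he
      simp at hnd huC hvC hUall hVall
      apply pairB0 (u := u) (v := v) (a := a) (b := b) (c := c) (d := d) <;>
        first | assumption | (apply SimpleGraph.Adj.symm; assumption) | (simp; grind)
    · obtain ⟨a, b, c, d, e, he, hnd, h1, h2, h3, h4, h5, h6, h7, h8⟩ := lab_five C hcV hn
      obtain ⟨ha, ha'⟩ := (hC a).1 (by simp [he])
      obtain ⟨hb, hb'⟩ := (hC b).1 (by simp [he])
      obtain ⟨hc, hc'⟩ := (hC c).1 (by simp [he])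
      obtain ⟨hd, hd'⟩ := (hC d).1 (by simp [he])
      obtain ⟨hee, hee'⟩ := (hC e).1 (by simp [he])
      subst he
      have := h3.symm
      have := h6.symm
      have := h7.symm
      have := h8.symm
      have := h1.symm
      have := h2.symm
      have := h4.symm
      have := h5.symm
      simp at hnd huC hvC hUall hVall
      by_cases hab : G.Adj a b <;> by_cases hcd : G.Adj c d
      · apply pairC0 (u := u) (v := v) (a := a) (b := b) (c := c) (d := d) (e := e) <;>
          first | assumption | (apply SimpleGraph.Adj.symm; assumption) | (simp; grind)
      · apply pairC1 (u := u) (v := v) (a := c) (b := d) (c := a) (d := b) (e := e) <;>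
          first | assumption | (apply SimpleGraph.Adj.symm; assumption) | (simp; grind)
      · apply pairC1 (u := u) (v := v) (a := a) (b := b) (c := c) (d := d) (e := e) <;>
          first | assumption | (apply SimpleGraph.Adj.symm; assumption) | (simp; grind)
      · apply pairC2 (u := u) (v := v) (a := a) (b := b) (c := c) (d := d) (e := e) <;>
          first | assumption | (apply SimpleGraph.Adj.symm; assumption) | (simp; grind)
  · rw [Finset.pair_comm]
    exact caseB1 huv.symm C hC' hn (by omega) hqC hqv huq hvq hVall hUall
  · exact caseB1 huv C hC hn (by omega) hpC hpu hvp hup hUall hVall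
  · have hpq : p ≠ q := fun h => hup (h ▸ huq)
    have hpv := hvp.ne
    have hqu := huq.ne
    rcases hcV with hcV | hcV
    · obtain ⟨a, b, c, he, hnd, h1, h2⟩ := lab_three C hcV hn
      obtain ⟨ha, ha'⟩ := (hC a).1 (by simp [he])
      obtain ⟨hb, hb'⟩ := (hC b).1 (by simp [he])
      obtain ⟨hc, hc'⟩ := (hC c).1 (by simp [he])
      subst he
      simp at hnd huC hvC hUall hVall hpC hqC hpc hqc
      obtain ⟨hp1, hp2, hp3⟩ := hpc
      obtain ⟨hq1, hq2, hq3⟩ := hqc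
      apply pairA (u := u) (v := v) (p := p) (q := q) (a := a) (b := b) (c := c) <;>
        first | assumption | (apply SimpleGraph.Adj.symm; assumption) | (simp; grind)
    · obtain ⟨a, b, c, d, he, hnd, h1, h2, h3, h4⟩ := lab_four C hcV hn
      obtain ⟨ha, ha'⟩ := (hC a).1 (by simp [he])
      obtain ⟨hb, hb'⟩ := (hC b).1 (by simp [he])
      obtain ⟨hc, hc'⟩ := (hC c).1 (by simp [he])
      obtain ⟨hd, hd'⟩ := (hC d).1 (by simp [he])
      subst he
      have := h4.symm
      simp at hnd huC hvC hUall hVall hpC hqC hpc hqc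
      obtain ⟨hp1, hp2, hp3, hp4⟩ := hpc
      obtain ⟨hq1, hq2, hq3, hq4⟩ := hqc
      by_cases hac : G.Adj a c
      · by_cases hbd : G.Adj b d
        · apply pairB3 (u := u) (v := v) (p := p) (q := q) (a := a) (b := b) (c := c) (d := d) <;>
            first | assumption | (apply SimpleGraph.Adj.symm; assumption) | (simp; grind)
        · have := h1.symm
          apply pairB2 (u := u) (v := v) (p := p) (q := q) (a := b) (b := c) (c := d) (d := a) <;>
            first | assumption | (apply SimpleGraph.Adj.symm; assumption) | (simp; grind)
      · apply pairB2 (u := u) (v := v) (p := p) (q := q) (a := a) (b := b) (c := c) (d := d) <;>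
          first | assumption | (apply SimpleGraph.Adj.symm; assumption) | (simp; grind)
end
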